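/- Assume that no matrix in A = {A_1,…,A_m} is Barabanov. Let d = n(n+1)/2, let N ∈ ℕ with N ≥ d, and let ε ∈ (0,1). Then ℙ^N({ω̄_N ∈ Δ^N : V_jsr(ω̄_N) > ε}) ≤ Φ(ε, d−1, N) = Σ_{j=0}^{d−1} C(N,j) ε^j (1−ε)^{N−j}, where V_jsr(ω̄_N) = ℙ({δ ∈ Δ : Cost_jsr(ω_N ∪ {δ}) > Cost_jsr(ω_N)}). -/

import Mathlib

open MeasureTheory Matrix Metric
open scoped ENNReal

/-- A real matrix `A` is *Barabanov* if there exist a symmetric positive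
definite matrix `P` and `γ ≥ 0` such that `AᵀPA = γ²P`. -/
def IsBarabanov {n : ℕ} (A : Matrix (Fin n) (Fin n) ℝ) : Prop :=
  ∃ P : Matrix (Fin n) (Fin n) ℝ, P.IsSymm ∧ P.PosDef ∧
    ∃ γ : ℝ, 0 ≤ γ ∧ Aᵀ * P * A = γ ^ 2 • P

/-- The sample space `Δ = 𝒜 × S^{n-1}`. -/
abbrev JsrSample (n m : ℕ) :=
  Fin m × ↥(sphere (0 : EuclideanSpace ℝ (Fin n)) 1)

/-- The uniform probability distribution `ℙ` on `Δ = 𝒜 × S^{n-1}`: product of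
the uniform distribution on the finite set `𝒜` and the normalized surface
measure on the sphere `S^{n-1}`. -/
noncomputable def jsrUniform (n m : ℕ) : Measure (JsrSample n m) :=
  ((m : ℝ≥0∞)⁻¹ • Measure.count).prod
    (((volume : Measure (EuclideanSpace ℝ (Fin n))).toSphere Set.univ)⁻¹ •
      (volume : Measure (EuclideanSpace ℝ (Fin n))).toSphere)

/-- The underlying vector in `ℝ^n` of a sample point. -/
def samplePoint {n m : ℕ} (δ : JsrSample n m) : Fin n → ℝ :=
  fun i => (δ.2 : EuclideanSpace ℝ (Fin n)) i

/-- Frobenius norm of a real matrix. -/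
noncomputable def frobNorm {n : ℕ} (P : Matrix (Fin n) (Fin n) ℝ) : ℝ :=
  Real.sqrt (∑ i, ∑ j, (P i j) ^ 2)

/-- Quadratic form `xᵀPx`. -/
def quadForm {n : ℕ} (P : Matrix (Fin n) (Fin n) ℝ) (x : Fin n → ℝ) : ℝ :=
  ∑ i, ∑ j, x i * P i j * x j

/-- Feasible points of the sampled problem `P_jsr(S)`: `γ ≥ 0`, `P` symmetric
with `P ⪰ I` and `‖P‖_F ≤ C`, and `(Ax)ᵀP(Ax) ≤ γ² xᵀPx` for all `(A,x) ∈ S`. -/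
def JsrFeasible {n m : ℕ} (𝒜 : Fin m → Matrix (Fin n) (Fin n) ℝ) (C : ℝ)
    (S : Set (JsrSample n m)) (γ : ℝ) (P : Matrix (Fin n) (Fin n) ℝ) : Prop :=
  0 ≤ γ ∧ P.IsSymm ∧ (P - 1).PosSemidef ∧ frobNorm P ≤ C ∧
    ∀ δ ∈ S, quadForm P ((𝒜 δ.1).mulVec (samplePoint δ)) ≤
      γ ^ 2 * quadForm P (samplePoint δ)

/-- Attainable values `(γ, ‖P‖_F²)`, in lexicographic order, of the sampled
problem `P_jsr(S)`. `Cost_jsr(S)` is the least element of this set. -/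
def JsrValues {n m : ℕ} (𝒜 : Fin m → Matrix (Fin n) (Fin n) ℝ) (C : ℝ)
    (S : Set (JsrSample n m)) : Set (ℝ ×ₗ ℝ) :=
  {p | ∃ γ P, JsrFeasible 𝒜 C S γ P ∧ p = toLex (γ, (frobNorm P) ^ 2)}

set_option linter.unusedSectionVars false

section PolyPart

open Polynomial

lemma poly_antideriv (Q : ℝ[X]) : ∃ P : ℝ[X], derivative P = Q ∧ P.eval 0 = 0 := by
  induction Q using Polynomial.induction_on' with
  | add p q hp hq =>
    obtain ⟨P, h1, h2⟩ := hp
    obtain ⟨R, h3, h4⟩ := hq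
    exact ⟨P + R, by simp [h1, h3], by simp [h2, h4]⟩
  | monomial n c =>
    refine ⟨monomial (n + 1) (c / (n + 1)), ?_, by simp⟩
    rw [derivative_monomial]
    have : ((n : ℝ) + 1) ≠ 0 := by positivity
    push_cast
    rw [div_mul_cancel₀ _ this]

lemma poly_mono (P R : ℝ[X]) (u v : ℝ)
    (h : ∀ t ∈ Set.Icc u v, (derivative P).eval t ≤ (derivative R).eval t)
    (t : ℝ) (ht : t ∈ Set.Icc u v) : P.eval t - P.eval u ≤ R.eval t - R.eval u := by
  have hm : MonotoneOn (fun x => (R - P).eval x) (Set.Icc u v) := by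
    apply monotoneOn_of_deriv_nonneg (convex_Icc u v)
    · exact (R - P).continuous.continuousOn
    · exact (R - P).differentiable.differentiableOn
    · intro x hx
      rw [interior_Icc] at hx
      have := h x ⟨hx.1.le, hx.2.le⟩
      rw [Polynomial.deriv]
      simp only [derivative_sub, eval_sub]
      linarith
  have := hm ⟨le_refl u, ht.1.trans ht.2⟩ ht ht.1
  simp only [eval_sub] at this
  linarith

/-- Taylor polynomial of `t ^ N` at `a`. -/
noncomputable def taylP (N d : ℕ) (a : ℝ) : ℝ[X] :=
  ∑ j ∈ Finset.range d, C ((N.choose j : ℝ) * a ^ (N - j)) * (X - C a) ^ j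

lemma taylP_eval (N d : ℕ) (a t : ℝ) : (taylP N d a).eval t =
    ∑ j ∈ Finset.range d, (N.choose j : ℝ) * a ^ (N - j) * (t - a) ^ j := by
  simp [taylP, eval_finsetSum]

lemma taylP_eval_self (N d : ℕ) (a : ℝ) : (taylP N (d + 1) a).eval a = a ^ N := by
  rw [taylP_eval, Finset.sum_range_succ']
  simp

lemma taylP_deriv (N d : ℕ) (a : ℝ) :
    derivative (taylP (N + 1) (d + 1) a) = C ((N : ℝ) + 1) * taylP N d a := by
  rw [taylP, Finset.sum_range_succ', derivative_add, derivative_sum, taylP, Finset.mul_sum]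
  simp only [pow_zero, mul_one, derivative_C, add_zero]
  apply Finset.sum_congr rfl
  intro j _
  rw [derivative_C_mul, derivative_X_sub_C_pow]
  have h := Nat.add_one_mul_choose_eq N j
  have h' : ((N : ℝ) + 1) * (N.choose j : ℝ) = ((N + 1).choose (j + 1) : ℝ) * (j + 1) := by
    exact_mod_cast h
  have e : N + 1 - (j + 1) = N - j := by omega
  rw [e, ← mul_assoc, ← mul_assoc, ← C_mul, ← C_mul, ← mul_assoc, h', Nat.add_sub_cancel]
  congr 2
  push_cast
  ring

/-- Polynomial majorant. -/
def GoodPoly (N d : ℕ) (a η : ℝ) (P : ℝ[X]) : Prop :=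
  (∀ k ≤ d, ∀ t ∈ Set.Icc (0 : ℝ) 1, t < a →
    (N.choose k : ℝ) * t ^ (N - k) ≤ (hasseDeriv k P).eval t) ∧
  (∀ k ≤ d, ∀ t ∈ Set.Icc (0 : ℝ) 1, 0 ≤ (hasseDeriv k P).eval t) ∧
  (∀ t ∈ Set.Icc (0 : ℝ) a, P.eval t ≤ t ^ N + η) ∧
  (∀ t ∈ Set.Icc a 1, P.eval t ≤ (taylP N d a).eval t + η)

lemma hasseDeriv_succ_eval (P : ℝ[X]) (k : ℕ) (t : ℝ) :
    ((k : ℝ) + 1) * (hasseDeriv (k + 1) P).eval t = (hasseDeriv k (derivative P)).eval t := by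
  have h := congrArg (fun L => (L P).eval t) (hasseDeriv_comp (R := ℝ) k 1)
  simp only [LinearMap.comp_apply, hasseDeriv_one, LinearMap.smul_apply] at h
  rw [h]
  simp [Nat.choose_succ_self_right]

/-- lower bounds pass to antiderivatives -/
lemma good_lower (N d : ℕ) (a : ℝ) (P Q : ℝ[X]) (hP : derivative P = C ((N : ℝ) + 1) * Q)
    (hP0 : P.eval 0 = 0)
    (h1 : ∀ k ≤ d, ∀ t ∈ Set.Icc (0 : ℝ) 1, t < a →
      (N.choose k : ℝ) * t ^ (N - k) ≤ (hasseDeriv k Q).eval t)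
    (h2 : ∀ k ≤ d, ∀ t ∈ Set.Icc (0 : ℝ) 1, 0 ≤ (hasseDeriv k Q).eval t) :
    (∀ k ≤ d + 1, ∀ t ∈ Set.Icc (0 : ℝ) 1, t < a →
      ((N + 1).choose k : ℝ) * t ^ (N + 1 - k) ≤ (hasseDeriv k P).eval t) ∧
    (∀ k ≤ d + 1, ∀ t ∈ Set.Icc (0 : ℝ) 1, 0 ≤ (hasseDeriv k P).eval t) := by
  have hN : (0 : ℝ) < (N : ℝ) + 1 := by positivity
  have key : ∀ (k : ℕ) (t : ℝ), ((k : ℝ) + 1) * (hasseDeriv (k + 1) P).eval t =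
      ((N : ℝ) + 1) * (hasseDeriv k Q).eval t := by
    intro k t
    rw [hasseDeriv_succ_eval, hP, ← smul_eq_C_mul, map_smul, eval_smul, smul_eq_mul]
  have hQ0 : ∀ t ∈ Set.Icc (0 : ℝ) 1, 0 ≤ Q.eval t := by
    intro t ht
    simpa using h2 0 (Nat.zero_le _) t ht
  have hQ1 : ∀ t ∈ Set.Icc (0 : ℝ) 1, t < a → t ^ N ≤ Q.eval t := by
    intro t ht hta
    simpa using h1 0 (Nat.zero_le _) t ht hta
  constructor
  · intro k hk t ht hta
    rcases k with _ | k
    · have := poly_mono (X ^ (N + 1)) P 0 t (by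
        intro s hs
        rw [hP]
        simp only [derivative_X_pow, eval_mul, eval_C, eval_pow, eval_X]
        have := hQ1 s ⟨hs.1, hs.2.trans ht.2⟩ (lt_of_le_of_lt hs.2 hta)
        push_cast
        exact mul_le_mul_of_nonneg_left this hN.le) t ⟨ht.1, le_refl t⟩
      simp [hP0] at this
      simpa using this
    · have h := h1 k (by omega) t ht hta
      have hk1 : (0 : ℝ) < (k : ℝ) + 1 := by positivity
      have hc : ((N : ℝ) + 1) * (N.choose k : ℝ) = ((N + 1).choose (k + 1) : ℝ) * (k + 1) := by
        exact_mod_cast Nat.add_one_mul_choose_eq N k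
      have e : N + 1 - (k + 1) = N - k := by omega
      rw [e]
      refine le_of_mul_le_mul_left ?_ hk1
      rw [key]
      calc ((k : ℝ) + 1) * (((N + 1).choose (k + 1) : ℝ) * t ^ (N - k))
          = ((N : ℝ) + 1) * ((N.choose k : ℝ) * t ^ (N - k)) := by
            rw [← mul_assoc, ← mul_assoc, hc]; ring
        _ ≤ _ := mul_le_mul_of_nonneg_left h hN.le
  · intro k hk t ht
    rcases k with _ | k
    · have := poly_mono 0 P 0 t (by
        intro s hs
        rw [hP]
        simp only [derivative_zero, eval_zero, eval_mul, eval_C]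
        exact mul_nonneg hN.le (hQ0 s ⟨hs.1, hs.2.trans ht.2⟩)) t ⟨ht.1, le_refl t⟩
      simpa [hP0] using this
    · have h := h2 k (by omega) t ht
      have hk1 : (0 : ℝ) < (k : ℝ) + 1 := by positivity
      refine le_of_mul_le_mul_left ?_ hk1
      rw [key, mul_zero]
      exact mul_nonneg hN.le h

lemma good_exists (a : ℝ) (ha0 : 0 < a) (ha1 : a < 1) (d : ℕ) :
    ∀ N, d ≤ N → ∀ η > 0, ∃ P, GoodPoly (N + 1) (d + 1) a η P := by
  induction d with
  | zero =>
    intro N _ η hη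
    have hN : (0 : ℝ) < (N : ℝ) + 1 := by positivity
    obtain ⟨δ, hδ0, hδ1, hδ2⟩ : ∃ δ : ℝ, 0 < δ ∧ δ ≤ 1 - a ∧ ((N : ℝ) + 1) * δ ≤ η / 2 := by
      refine ⟨min (1 - a) (η / 2 / ((N : ℝ) + 1)), lt_min (by linarith) (by positivity),
        min_le_left _ _, ?_⟩
      calc _ ≤ ((N : ℝ) + 1) * (η / 2 / ((N : ℝ) + 1)) :=
            mul_le_mul_of_nonneg_left (min_le_right _ _) hN.le
        _ = η / 2 := by field_simp
    set η' : ℝ := η / 4 / ((N : ℝ) + 1) with hη'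
    have hη'0 : 0 < η' := by positivity
    let c : ℝ → ℝ := fun t => max 0 (min 1 (1 - (t - a) / δ))
    have hc0 : ∀ t, 0 ≤ c t := fun t => le_max_left _ _
    have hc1 : ∀ t, c t ≤ 1 := fun t => max_le zero_le_one (min_le_left _ _)
    have hca : ∀ t ≤ a, c t = 1 := by
      intro t ht
      have : (t - a) / δ ≤ 0 := div_nonpos_of_nonpos_of_nonneg (by linarith) hδ0.le
      simp only [c]
      rw [min_eq_left (by linarith), max_eq_right zero_le_one]
    have hcb : ∀ t, a + δ ≤ t → c t = 0 := by
      intro t ht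
      have : 1 ≤ (t - a) / δ := by rw [le_div_iff₀ hδ0]; linarith
      simp only [c]
      exact max_eq_left ((min_le_right _ _).trans (by linarith))
    have hcont : Continuous (fun t : ℝ => t ^ N * c t) := by
      simp only [c]; fun_prop
    obtain ⟨r, hr⟩ := exists_polynomial_near_of_continuousOn 0 1 (fun t => t ^ N * c t + η')
      (hcont.add continuous_const).continuousOn η' hη'0
    have hr1 : ∀ t ∈ Set.Icc (0 : ℝ) 1, t ^ N * c t ≤ r.eval t := by
      intro t ht
      have := (abs_lt.1 (hr t ht)).1
      linarith
    have hr2 : ∀ t ∈ Set.Icc (0 : ℝ) 1, r.eval t ≤ t ^ N * c t + 2 * η' := by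
      intro t ht
      have := (abs_lt.1 (hr t ht)).2
      linarith
    obtain ⟨P, hP, hP0⟩ := poly_antideriv (C ((N : ℝ) + 1) * r)
    have hη4 : ((N : ℝ) + 1) * (2 * η') = η / 2 := by rw [hη']; field_simp; ring
    obtain ⟨hl1, hl2⟩ := good_lower N 0 a P r hP hP0
      (by
        intro k hk t ht hta
        obtain rfl : k = 0 := by omega
        have := hr1 t ht
        rw [hca t hta.le] at this
        simpa using this)
      (by
        intro k hk t ht
        obtain rfl : k = 0 := by omega
        have := hr1 t ht
        simpa using (mul_nonneg (pow_nonneg ht.1 N) (hc0 t)).trans this)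
    have hA : ∀ t ∈ Set.Icc (0 : ℝ) a, P.eval t ≤ t ^ (N + 1) + η / 2 * t := by
      intro t ht
      have := poly_mono P (X ^ (N + 1) + C (η / 2) * X) 0 a (by
        intro s hs
        rw [hP]
        have h := hr2 s ⟨hs.1, hs.2.trans ha1.le⟩
        rw [hca s hs.2] at h
        have h' := mul_le_mul_of_nonneg_left h hN.le
        rw [mul_add, hη4] at h'
        simp
        linarith) t ht
      simp [hP0] at this
      linarith
    have hAa := hA a ⟨ha0.le, le_refl a⟩
    have hB : ∀ t ∈ Set.Icc a (a + δ), P.eval t ≤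
        a ^ (N + 1) + ((N : ℝ) + 1) * (t - a) + η / 2 * t := by
      intro t ht
      have := poly_mono P (C ((N : ℝ) + 1) * X + C (η / 2) * X) a (a + δ) (by
        intro s hs
        rw [hP]
        have hs' : s ∈ Set.Icc (0 : ℝ) 1 := ⟨ha0.le.trans hs.1, by linarith [hs.2]⟩
        have h := hr2 s hs'
        have h3 : s ^ N * c s ≤ 1 :=
          mul_le_one₀ (pow_le_one₀ hs'.1 hs'.2) (hc0 s) (hc1 s)
        have h' := mul_le_mul_of_nonneg_left (h.trans (add_le_add_left h3 _)) hN.le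
        rw [mul_add, hη4] at h'
        simp
        linarith) t ht
      simp at this
      linarith
    have hBa := hB (a + δ) ⟨by linarith, le_refl _⟩
    have hC : ∀ t ∈ Set.Icc (a + δ) 1, P.eval t ≤
        a ^ (N + 1) + ((N : ℝ) + 1) * δ + η / 2 * t := by
      intro t ht
      have := poly_mono P (C (η / 2) * X) (a + δ) 1 (by
        intro s hs
        rw [hP]
        have hs' : s ∈ Set.Icc (0 : ℝ) 1 := ⟨by linarith [hs.1], hs.2⟩
        have h := hr2 s hs'
        rw [hcb s hs.1] at h
        have h' := mul_le_mul_of_nonneg_left h hN.le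
        rw [mul_add, hη4] at h'
        simp
        linarith) t ht
      simp at this
      linarith
    refine ⟨P, hl1, hl2, ?_, ?_⟩
    · intro t ht
      have := hA t ht
      nlinarith [ht.1, ht.2]
    · intro t ht
      have e : (taylP (N + 1) (0 + 1) a).eval t = a ^ (N + 1) := by
        rw [taylP_eval]; simp
      rw [e]
      have h2 : η / 2 * t ≤ η / 2 := by nlinarith [ht.2]
      rcases le_total t (a + δ) with h | h
      · have h3 := hB t ⟨ht.1, h⟩
        have h4 : ((N : ℝ) + 1) * (t - a) ≤ ((N : ℝ) + 1) * δ :=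
          mul_le_mul_of_nonneg_left (by linarith) hN.le
        linarith
      · have h3 := hC t ⟨h, ht.2⟩
        linarith
  | succ d ih =>
    intro N hN' η hη
    obtain ⟨N, rfl⟩ : ∃ N', N = N' + 1 := ⟨N - 1, by omega⟩
    have hN : (0 : ℝ) < ((N + 1 : ℕ) : ℝ) + 1 := by positivity
    obtain ⟨Q, hQ1, hQ2, hQ3, hQ4⟩ := ih N (by omega) (η / (((N + 1 : ℕ) : ℝ) + 1)) (by positivity)
    have hηe : (((N + 1 : ℕ) : ℝ) + 1) * (η / (((N + 1 : ℕ) : ℝ) + 1)) = η := by field_simp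
    obtain ⟨P, hP, hP0⟩ := poly_antideriv (C (((N + 1 : ℕ) : ℝ) + 1) * Q)
    obtain ⟨hl1, hl2⟩ := good_lower (N + 1) (d + 1) a P Q hP hP0 hQ1 hQ2
    have hA : ∀ t ∈ Set.Icc (0 : ℝ) a, P.eval t ≤ t ^ (N + 1 + 1) + η * t := by
      intro t ht
      have := poly_mono P (X ^ (N + 1 + 1) + C η * X) 0 a (by
        intro s hs
        rw [hP]
        have h' := mul_le_mul_of_nonneg_left (hQ3 s hs) hN.le
        rw [mul_add, hηe] at h'
        simp only [eval_mul, eval_C, derivative_add, derivative_X_pow, derivative_C_mul,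
          derivative_X, eval_add, eval_pow, eval_X, mul_one, Nat.add_sub_cancel]
        push_cast at h' ⊢
        linarith) t ht
      simp [hP0] at this
      linarith
    have hAa := hA a ⟨ha0.le, le_refl a⟩
    refine ⟨P, hl1, hl2, ?_, ?_⟩
    · intro t ht
      have := hA t ht
      nlinarith [ht.1, ht.2]
    · intro t ht
      have := poly_mono P (taylP (N + 1 + 1) (d + 1 + 1) a + C η * X) a 1 (by
        intro s hs
        rw [hP, derivative_add, taylP_deriv]
        have h' := mul_le_mul_of_nonneg_left (hQ4 s hs) hN.le
        rw [mul_add, hηe] at h'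
        simp only [eval_mul, eval_C, derivative_C_mul,
          derivative_X, eval_add, mul_one]
        linarith) t ht
      simp only [eval_add, eval_mul, eval_C, eval_X, taylP_eval_self] at this
      nlinarith [ht.1, ht.2]

end PolyPart
section MomentPart

open Polynomial

lemma poly_integrable (ν : Measure ℝ) [IsFiniteMeasure ν]
    (hs : ∀ᵐ t ∂ν, t ∈ Set.Icc (0 : ℝ) 1) (P : ℝ[X]) : Integrable (fun t => P.eval t) ν := by
  obtain ⟨B, hB⟩ := (isCompact_Icc (a := (0 : ℝ)) (b := 1)).exists_bound_of_continuousOn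
    P.continuous.continuousOn
  refine Integrable.of_bound P.continuous.aestronglyMeasurable B ?_
  filter_upwards [hs] with t ht using hB t ht

lemma poly_moment (d : ℕ) (ν : ℕ → Measure ℝ) [∀ k, IsFiniteMeasure (ν k)]
    (hs : ∀ k, ∀ᵐ t ∂(ν k), t ∈ Set.Icc (0 : ℝ) 1)
    (h1 : ∀ M : ℕ, ∑ k ∈ Finset.range d, (M.choose k : ℝ) * ∫ t, t ^ (M - k) ∂(ν k) = 1)
    (P : ℝ[X]) :
    ∑ k ∈ Finset.range d, ∫ t, (hasseDeriv k P).eval t ∂(ν k) = P.eval 1 := by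
  induction P using Polynomial.induction_on' with
  | add p q hp hq =>
    rw [eval_add, ← hp, ← hq, ← Finset.sum_add_distrib]
    apply Finset.sum_congr rfl
    intro k _
    rw [← integral_add (poly_integrable _ (hs k) _) (poly_integrable _ (hs k) _)]
    simp
  | monomial n c =>
    have := congrArg (fun x => c * x) (h1 n)
    simp only [Finset.mul_sum, mul_one] at this
    rw [eval_monomial, one_pow, mul_one]
    refine Eq.trans ?_ this
    apply Finset.sum_congr rfl
    intro k _
    simp only [hasseDeriv_monomial, eval_monomial]
    rw [integral_const_mul]
    ring

lemma moment_bound (d N : ℕ) (hN : d + 1 ≤ N) (a : ℝ) (ha0 : 0 < a) (ha1 : a < 1)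
    (ν : ℕ → Measure ℝ) [∀ k, IsFiniteMeasure (ν k)]
    (hs : ∀ k, ∀ᵐ t ∂(ν k), t ∈ Set.Icc (0 : ℝ) 1)
    (h1 : ∀ M : ℕ, ∑ k ∈ Finset.range (d + 2), (M.choose k : ℝ) * ∫ t, t ^ (M - k) ∂(ν k) = 1) :
    ∑ k ∈ Finset.range (d + 2), (N.choose k : ℝ) * ∫ t in Set.Iio a, t ^ (N - k) ∂(ν k) ≤
      ∑ j ∈ Finset.range (d + 1), (N.choose j : ℝ) * (1 - a) ^ j * a ^ (N - j) := by
  apply le_of_forall_pos_le_add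
  intro η hη
  obtain ⟨M, rfl⟩ : ∃ M, N = M + 1 := ⟨N - 1, by omega⟩
  obtain ⟨P, hP1, hP2, -, hP4⟩ := good_exists a ha0 ha1 d M (by omega) η hη
  have h := hP4 1 ⟨ha1.le, le_refl _⟩
  rw [← poly_moment (d + 2) ν hs h1 P, taylP_eval] at h
  have e : ∑ j ∈ Finset.range (d + 1), ((M + 1).choose j : ℝ) * a ^ (M + 1 - j) * (1 - a) ^ j =
      ∑ j ∈ Finset.range (d + 1), ((M + 1).choose j : ℝ) * (1 - a) ^ j * a ^ (M + 1 - j) :=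
    Finset.sum_congr rfl (fun j _ => by ring)
  rw [e] at h
  refine le_trans (Finset.sum_le_sum ?_) h
  intro k hk
  have hk' : k ≤ d + 1 := by have := Finset.mem_range.1 hk; omega
  rw [← integral_const_mul, ← integral_indicator measurableSet_Iio]
  apply integral_mono_ae
  · refine Integrable.indicator ?_ measurableSet_Iio
    have := poly_integrable (ν k) (hs k) (C ((M + 1).choose k : ℝ) * X ^ (M + 1 - k))
    simpa only [eval_mul, eval_C, eval_pow, eval_X] using this
  · exact poly_integrable _ (hs k) _
  · filter_upwards [hs k] with t ht
    by_cases hta : t < a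
    · rw [Set.indicator_of_mem (show t ∈ Set.Iio a from hta)]
      exact hP1 k hk' t ht hta
    · rw [Set.indicator_of_notMem (show t ∉ Set.Iio a from hta)]
      exact hP2 k hk' t ht

end MomentPart
section ProbPart

variable {Δ Θ : Type*} [MeasurableSpace Δ] [MeasurableSpace Θ]

/-- Probability of non-violation. -/
noncomputable def okProb (μ : Measure Δ) (f : Θ → Δ → ℝ) (p : Θ) : ℝ := μ.real {δ | f p δ ≤ 0}

/-- Tuples all of whose elements are active. -/
def fullSet (θ : Set Δ → Θ) (f : Θ → Δ → ℝ) (ι : Type*) : Set (ι → Δ) :=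
  {ω | ∀ i, f (θ (Set.range ω)) (ω i) = 0}

/-- Law of the non-violation probability on full tuples. -/
noncomputable def okLaw (μ : Measure Δ) (θ : Set Δ → Θ) (f : Θ → Δ → ℝ) (k : ℕ) : Measure ℝ :=
  ((Measure.pi fun _ : Fin k => μ).restrict (fullSet θ f (Fin k))).map
    (fun ω => okProb μ f (θ (Set.range ω)))

/-- The index set `I` is the selected one. -/
def selSet (θ : Set Δ → Θ) (f : Θ → Δ → ℝ) {ι : Type*} (I : Finset ι) : Set (ι → Δ) :=
  {ω | (∀ i ∈ I, f (θ (ω '' I)) (ω i) = 0) ∧ ∀ i ∉ I, f (θ (ω '' I)) (ω i) ≤ 0}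

lemma measurable_okProb (μ : Measure Δ) [IsProbabilityMeasure μ] (f : Θ → Δ → ℝ)
    (hf : Measurable (fun p : Θ × Δ => f p.1 p.2)) : Measurable (okProb μ f) := by
  have h : MeasurableSet {p : Θ × Δ | f p.1 p.2 ≤ 0} := measurableSet_le hf measurable_const
  exact (measurable_measure_prodMk_left h).ennreal_toReal

lemma okProb_mem (μ : Measure Δ) [IsProbabilityMeasure μ] (f : Θ → Δ → ℝ) (p : Θ) :
    okProb μ f p ∈ Set.Icc (0 : ℝ) 1 := ⟨measureReal_nonneg, measureReal_le_one⟩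

lemma measurable_theta (θ : Set Δ → Θ)
    (hθ : ∀ k, Measurable (fun ω : Fin k → Δ => θ (Set.range ω))) (ι : Type*) [Fintype ι] :
    Measurable (fun ω : ι → Δ => θ (Set.range ω)) := by
  let e := (Fintype.equivFin ι).symm
  have h : (fun ω : ι → Δ => θ (Set.range ω)) =
      (fun ω : Fin (Fintype.card ι) → Δ => θ (Set.range ω)) ∘ (fun ω => ω ∘ e) := by
    funext ω
    simp only [Function.comp_apply]
    rw [e.surjective.range_comp]
  rw [h]
  exact (hθ _).comp (measurable_pi_lambda _ (fun i => measurable_pi_apply _))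

lemma measurableSet_full (θ : Set Δ → Θ) (f : Θ → Δ → ℝ)
    (hf : Measurable (fun p : Θ × Δ => f p.1 p.2))
    (hθ : ∀ k, Measurable (fun ω : Fin k → Δ => θ (Set.range ω))) (ι : Type*) [Fintype ι] :
    MeasurableSet (fullSet θ f ι) := by
  have : fullSet θ f ι = ⋂ i, {ω | f (θ (Set.range ω)) (ω i) = 0} := by
    ext ω; simp [fullSet]
  rw [this]
  refine MeasurableSet.iInter (fun i => ?_)
  have h : Measurable (fun ω : ι → Δ => f (θ (Set.range ω)) (ω i)) :=
    hf.comp ((measurable_theta θ hθ ι).prodMk (measurable_pi_apply i))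
  exact h (measurableSet_singleton 0)

lemma image_eq_range_restrict {ι : Type*} (I : Finset ι) (ω : ι → Δ) :
    ω '' (I : Set ι) = Set.range (fun i : {i // i ∈ I} => ω i) := by
  ext x; simp

lemma sel_fubini (μ : Measure Δ) [IsProbabilityMeasure μ] (θ : Set Δ → Θ) (f : Θ → Δ → ℝ)
    (hf : Measurable (fun p : Θ × Δ => f p.1 p.2))
    (hθ : ∀ k, Measurable (fun ω : Fin k → Δ => θ (Set.range ω)))
    {M : ℕ} (I : Finset (Fin M)) (T : Set ℝ) (hT : MeasurableSet T) :
    (Measure.pi fun _ : Fin M => μ)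
      (selSet θ f I ∩ {ω | okProb μ f (θ (ω '' I)) ∈ T}) =
      ∫⁻ t in T, ENNReal.ofReal t ^ (M - I.card) ∂(okLaw μ θ f I.card) := by
  classical
  have hok := measurable_okProb μ f hf
  have hth := measurable_theta θ hθ {i // i ∈ I}
  set Z : Set (({i // i ∈ I} → Δ) × ({i // i ∉ I} → Δ)) :=
    {z | (z.1 ∈ fullSet θ f {i // i ∈ I} ∧ okProb μ f (θ (Set.range z.1)) ∈ T) ∧
      ∀ j, f (θ (Set.range z.1)) (z.2 j) ≤ 0} with hZ
  have hF : MeasurableSet {x : {i // i ∈ I} → Δ | x ∈ fullSet θ f {i // i ∈ I} ∧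
      okProb μ f (θ (Set.range x)) ∈ T} :=
    (measurableSet_full θ f hf hθ _).inter ((hok.comp hth) hT)
  have hZm : MeasurableSet Z := by
    suffices hA : MeasurableSet {z : ({i // i ∈ I} → Δ) × ({i // i ∉ I} → Δ) |
        ∀ j, f (θ (Set.range z.1)) (z.2 j) ≤ 0} from (measurable_fst hF).inter hA
    have : {z : ({i // i ∈ I} → Δ) × ({i // i ∉ I} → Δ) |
        ∀ j, f (θ (Set.range z.1)) (z.2 j) ≤ 0} =
        ⋂ j, {z | f (θ (Set.range z.1)) (z.2 j) ≤ 0} := by ext; simp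
    rw [this]
    refine MeasurableSet.iInter (fun j => measurableSet_le ?_ measurable_const)
    exact hf.comp ((hth.comp measurable_fst).prodMk
      ((measurable_pi_apply j).comp measurable_snd))
  have hmp := measurePreserving_piEquivPiSubtypeProd (fun _ : Fin M => μ) (fun i => i ∈ I)
  have hpre : selSet θ f I ∩ {ω | okProb μ f (θ (ω '' I)) ∈ T} =
      (MeasurableEquiv.piEquivPiSubtypeProd (fun _ : Fin M => Δ) (fun i => i ∈ I)) ⁻¹' Z := by
    ext ω
    simp only [hZ, selSet, fullSet, Set.mem_inter_iff, Set.mem_ofPred_eq, Set.mem_preimage,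
      image_eq_range_restrict]
    constructor
    · rintro ⟨⟨h1, h2⟩, h3⟩
      exact ⟨⟨fun i => h1 i i.2, h3⟩, fun j => h2 j j.2⟩
    · rintro ⟨⟨h1, h3⟩, h2⟩
      exact ⟨⟨fun i hi => h1 ⟨i, hi⟩, fun i hi => h2 ⟨i, hi⟩⟩, h3⟩
  rw [hpre, hmp.measure_preimage hZm.nullMeasurableSet, Measure.prod_apply hZm]
  have hcard : Fintype.card {i // i ∉ I} = M - I.card := by
    rw [Fintype.card_subtype_compl]; simp
  have hsec : ∀ x : {i // i ∈ I} → Δ,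
      (Measure.pi fun _ : {i // i ∉ I} => μ) (Prod.mk x ⁻¹' Z) =
      Set.indicator {x : {i // i ∈ I} → Δ | x ∈ fullSet θ f {i // i ∈ I} ∧
        okProb μ f (θ (Set.range x)) ∈ T}
        (fun x => ENNReal.ofReal (okProb μ f (θ (Set.range x))) ^ (M - I.card)) x := by
    intro x
    by_cases hx : x ∈ {x : {i // i ∈ I} → Δ | x ∈ fullSet θ f {i // i ∈ I} ∧
        okProb μ f (θ (Set.range x)) ∈ T}
    · rw [Set.indicator_of_mem hx]
      have : Prod.mk x ⁻¹' Z = Set.univ.pi (fun _ : {i // i ∉ I} =>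
          {δ | f (θ (Set.range x)) δ ≤ 0}) := by
        ext y
        simp only [hZ, Set.mem_preimage, Set.mem_ofPred_eq, Set.mem_pi, Set.mem_univ, true_imp_iff]
        exact ⟨fun h => h.2, fun h => ⟨hx, h⟩⟩
      rw [this, Measure.pi_pi, Finset.prod_const, Finset.card_univ, hcard, okProb,
        ofReal_measureReal]
    · rw [Set.indicator_of_notMem hx]
      have : Prod.mk x ⁻¹' Z = ∅ := by
        ext y
        simp only [hZ, Set.mem_preimage, Set.mem_ofPred_eq, Set.mem_empty_iff_false, iff_false]
        exact fun h => hx h.1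
      rw [this, measure_empty]
  have hpw : Measurable (fun t : ℝ => ENNReal.ofReal t ^ (M - I.card)) :=
    ENNReal.measurable_ofReal.pow_const _
  refine (lintegral_congr hsec).trans ?_
  -- transfer to `Fin k`
  let e : Fin I.card ≃ {i // i ∈ I} := I.equivFin.symm
  have hmp2 := measurePreserving_piCongrLeft (fun _ : {i // i ∈ I} => μ) e
  refine Eq.trans (?_ : _ = ∫⁻ x : {i // i ∈ I} → Δ,
      Set.indicator {x : {i // i ∈ I} → Δ | x ∈ fullSet θ f {i // i ∈ I} ∧
        okProb μ f (θ (Set.range x)) ∈ T}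
        (fun x => ENNReal.ofReal (okProb μ f (θ (Set.range x))) ^ (M - I.card)) x
        ∂(Measure.pi fun _ : {i // i ∈ I} => μ)) ?_
  · congr!
  rw [← hmp2.lintegral_comp_emb (MeasurableEquiv.measurableEmbedding _)]
  have hcm : Measurable (fun ω : Fin I.card → Δ => okProb μ f (θ (Set.range ω))) :=
    hok.comp (hθ _)
  rw [okLaw, Measure.restrict_map hcm hT, lintegral_map hpw hcm,
    Measure.restrict_restrict (hcm hT), ← lintegral_indicator
      ((hcm hT).inter (measurableSet_full θ f hf hθ _))]
  refine lintegral_congr (fun y => ?_)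
  have hy : ∀ j, (MeasurableEquiv.piCongrLeft (fun _ : {i // i ∈ I} => Δ) e) y (e j) = y j := by
    intro j
    rw [MeasurableEquiv.coe_piCongrLeft, Equiv.piCongrLeft_apply_apply]
  have hyr : Set.range ((MeasurableEquiv.piCongrLeft (fun _ : {i // i ∈ I} => Δ) e) y) =
      Set.range y := by
    rw [← e.surjective.range_comp]
    congr 1
    funext j
    exact hy j
  have hiff : (MeasurableEquiv.piCongrLeft (fun _ : {i // i ∈ I} => Δ) e) y ∈
      {x : {i // i ∈ I} → Δ | x ∈ fullSet θ f {i // i ∈ I} ∧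
        okProb μ f (θ (Set.range x)) ∈ T} ↔
      y ∈ ((fun ω : Fin I.card → Δ => okProb μ f (θ (Set.range ω))) ⁻¹' T) ∩
        fullSet θ f (Fin I.card) := by
    simp only [fullSet, Set.mem_ofPred_eq, hyr, Set.mem_inter_iff, Set.mem_preimage]
    rw [and_comm]
    refine and_congr Iff.rfl ?_
    rw [← e.forall_congr_right]
    simp only [hy]
  by_cases hm : y ∈ ((fun ω : Fin I.card → Δ => okProb μ f (θ (Set.range ω))) ⁻¹' T) ∩
        fullSet θ f (Fin I.card)
  · rw [Set.indicator_of_mem (hiff.2 hm), hyr]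
    exact (Set.indicator_of_mem hm (fun a : Fin I.card → Δ =>
      ENNReal.ofReal (okProb μ f (θ (Set.range a))) ^ (M - I.card))).symm
  · rw [Set.indicator_of_notMem (fun h => hm (hiff.1 h))]
    exact (Set.indicator_of_notMem hm (fun a : Fin I.card → Δ =>
      ENNReal.ofReal (okProb μ f (θ (Set.range a))) ^ (M - I.card))).symm

lemma ae_inactive (μ : Measure Δ) [IsProbabilityMeasure μ] (θ : Set Δ → Θ) (f : Θ → Δ → ℝ)
    (hf : Measurable (fun p : Θ × Δ => f p.1 p.2))
    (hθ : ∀ k, Measurable (fun ω : Fin k → Δ => θ (Set.range ω)))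
    (hnull : ∀ S : Set Δ, S.Finite → μ {δ | f (θ S) δ = 0} = 0) (M : ℕ) :
    ∀ᵐ ω ∂(Measure.pi fun _ : Fin M => μ), ∀ I : Finset (Fin M), ∀ i ∉ I,
      f (θ (ω '' I)) (ω i) ≠ 0 := by
  classical
  rw [ae_all_iff]
  intro I
  rw [ae_all_iff]
  intro i
  by_cases hi : i ∈ I
  · simp [hi]
  simp only [hi, not_false_eq_true, true_imp_iff]
  have hmp := measurePreserving_piEquivPiSubtypeProd (fun _ : Fin M => μ) (fun i => i ∈ I)
  have hth := measurable_theta θ hθ {i // i ∈ I}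
  set Z : Set (({i // i ∈ I} → Δ) × ({i // i ∉ I} → Δ)) :=
    {z | f (θ (Set.range z.1)) (z.2 ⟨i, hi⟩) = 0} with hZ
  have hZm : MeasurableSet Z := by
    have : Measurable (fun z : ({i // i ∈ I} → Δ) × ({i // i ∉ I} → Δ) =>
        f (θ (Set.range z.1)) (z.2 ⟨i, hi⟩)) :=
      hf.comp ((hth.comp measurable_fst).prodMk
        ((measurable_pi_apply _).comp measurable_snd))
    exact this (measurableSet_singleton 0)
  rw [ae_iff]
  have hpre : {ω : Fin M → Δ | ¬ f (θ (ω '' I)) (ω i) ≠ 0} =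
      (MeasurableEquiv.piEquivPiSubtypeProd (fun _ : Fin M => Δ) (fun i => i ∈ I)) ⁻¹' Z := by
    ext ω
    simp only [hZ, Set.mem_ofPred_eq, Set.mem_preimage, image_eq_range_restrict, not_not, ne_eq]
    exact Iff.rfl
  rw [hpre, hmp.measure_preimage hZm.nullMeasurableSet, Measure.measure_prod_null hZm]
  refine Filter.Eventually.of_forall (fun x => ?_)
  have h0 := hnull (Set.range x) (Set.finite_range x)
  have hev := measurePreserving_eval (fun _ : {i // i ∉ I} => μ) ⟨i, hi⟩
  have hm : MeasurableSet {δ | f (θ (Set.range x)) δ = 0} :=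
    (hf.comp (measurable_const.prodMk measurable_id)) (measurableSet_singleton 0)
  have := hev.measure_preimage hm.nullMeasurableSet
  rw [h0] at this
  exact this

lemma ae_select (μ : Measure Δ) [IsProbabilityMeasure μ] (θ : Set Δ → Θ) (f : Θ → Δ → ℝ)
    (hf : Measurable (fun p : Θ × Δ => f p.1 p.2))
    (hθ : ∀ k, Measurable (fun ω : Fin k → Δ => θ (Set.range ω)))
    (hnull : ∀ S : Set Δ, S.Finite → μ {δ | f (θ S) δ = 0} = 0)
    (hfeas : ∀ S : Set Δ, S.Finite → ∀ δ ∈ S, f (θ S) δ ≤ 0)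
    (hloc : ∀ S T : Set Δ, T.Finite → S ⊆ T → (∀ δ ∈ T, f (θ S) δ ≤ 0) → θ T = θ S)
    (hact : ∀ S T : Set Δ, T.Finite → S ⊆ T → (∀ δ ∈ T, δ ∉ S → f (θ T) δ < 0) → θ S = θ T)
    (d : ℕ) (hhel : ∀ T : Set Δ, T.Finite → ∃ S : Finset Δ, ↑S ⊆ T ∧ S.card ≤ d ∧ θ S = θ T)
    (M : ℕ) :
    ∀ᵐ ω ∂(Measure.pi fun _ : Fin M => μ), ∃ I : Finset (Fin M), I.card ≤ d ∧
      θ (ω '' I) = θ (Set.range ω) ∧ ∀ J, ω ∈ selSet θ f J ↔ J = I := by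
  classical
  filter_upwards [ae_inactive μ θ f hf hθ hnull M] with ω hω
  have hfin := Set.finite_range ω
  set I : Finset (Fin M) := Finset.univ.filter (fun i => f (θ (Set.range ω)) (ω i) = 0) with hI
  have hmem : ∀ i, i ∈ I ↔ f (θ (Set.range ω)) (ω i) = 0 := by simp [hI]
  have hsub : ∀ J : Finset (Fin M), ω '' J ⊆ Set.range ω := fun J => Set.image_subset_range _ _
  have hth : θ (ω '' I) = θ (Set.range ω) := by
    apply hact _ _ hfin (hsub I)
    rintro δ ⟨i, rfl⟩ hi
    refine lt_of_le_of_ne (hfeas _ hfin _ ⟨i, rfl⟩) (fun h => hi ?_)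
    exact ⟨i, (hmem i).2 h, rfl⟩
  refine ⟨I, ?_, hth, fun J => ⟨fun hJ => ?_, ?_⟩⟩
  · rcases isEmpty_or_nonempty (Fin M) with hem | hne
    · rw [Finset.eq_empty_of_isEmpty I]; simp
    obtain ⟨S, hS1, hS2, hS3⟩ := hhel _ hfin
    have : ∀ δ ∈ S, ∃ i, ω i = δ := fun δ hδ => hS1 hδ
    choose! g hg using this
    have him : ω '' (S.image g : Finset (Fin M)) = S := by
      ext δ
      simp only [Finset.coe_image, Set.mem_image, Finset.mem_coe, exists_exists_and_eq_and]
      constructor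
      · rintro ⟨b, hb, rfl⟩; rwa [hg b hb]
      · intro h; exact ⟨δ, h, hg δ h⟩
    have hsubset : I ⊆ S.image g := by
      intro i hi
      by_contra hni
      have := hω (S.image g) i hni
      rw [him, hS3] at this
      exact this ((hmem i).1 hi)
    exact (Finset.card_le_card hsubset).trans (Finset.card_image_le.trans hS2)
  · have hJth : θ (Set.range ω) = θ (ω '' J) := by
      apply hloc _ _ hfin (hsub J)
      rintro δ ⟨i, rfl⟩
      by_cases hi : i ∈ J
      · exact (hJ.1 i hi).le
      · exact hJ.2 i hi
    ext i
    rw [hmem, hJth]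
    constructor
    · exact hJ.1 i
    · intro h
      by_contra hi
      exact hω J i hi h
  · rintro rfl
    refine ⟨fun i hi => ?_, fun i _ => ?_⟩
    · rw [hth]; exact (hmem i).1 hi
    · rw [hth]; exact hfeas _ hfin _ ⟨i, rfl⟩

lemma measurableSet_sel (μ : Measure Δ) [IsProbabilityMeasure μ] (θ : Set Δ → Θ) (f : Θ → Δ → ℝ)
    (hf : Measurable (fun p : Θ × Δ => f p.1 p.2))
    (hθ : ∀ k, Measurable (fun ω : Fin k → Δ => θ (Set.range ω)))
    {M : ℕ} (I : Finset (Fin M)) (T : Set ℝ) (hT : MeasurableSet T) :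
    MeasurableSet (selSet θ f I ∩ {ω | okProb μ f (θ (ω '' I)) ∈ T}) := by
  have hok := measurable_okProb μ f hf
  have hth : Measurable (fun ω : Fin M → Δ => θ (ω '' I)) := by
    simp only [image_eq_range_restrict]
    exact (measurable_theta θ hθ {i // i ∈ I}).comp
      (measurable_pi_lambda _ (fun i => measurable_pi_apply _))
  have hfi : ∀ i, Measurable (fun ω : Fin M → Δ => f (θ (ω '' I)) (ω i)) :=
    fun i => hf.comp (hth.prodMk (measurable_pi_apply i))
  refine MeasurableSet.inter ?_ ((hok.comp hth) hT)
  have : selSet θ f I = (⋂ i, ⋂ (_ : i ∈ I), {ω : Fin M → Δ | f (θ (ω '' I)) (ω i) = 0}) ∩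
      (⋂ i, ⋂ (_ : i ∉ I), {ω : Fin M → Δ | f (θ (ω '' I)) (ω i) ≤ 0}) := by
    ext ω; simp [selSet]
  rw [this]
  refine MeasurableSet.inter ?_ ?_
  · exact MeasurableSet.iInter (fun i => MeasurableSet.iInter
      (fun _ => hfi i (measurableSet_singleton 0)))
  · exact MeasurableSet.iInter (fun i => MeasurableSet.iInter
      (fun _ => measurableSet_le (hfi i) measurable_const))

lemma prob_identity (μ : Measure Δ) [IsProbabilityMeasure μ] (θ : Set Δ → Θ) (f : Θ → Δ → ℝ)
    (hf : Measurable (fun p : Θ × Δ => f p.1 p.2))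
    (hθ : ∀ k, Measurable (fun ω : Fin k → Δ => θ (Set.range ω)))
    (hnull : ∀ S : Set Δ, S.Finite → μ {δ | f (θ S) δ = 0} = 0)
    (hfeas : ∀ S : Set Δ, S.Finite → ∀ δ ∈ S, f (θ S) δ ≤ 0)
    (hloc : ∀ S T : Set Δ, T.Finite → S ⊆ T → (∀ δ ∈ T, f (θ S) δ ≤ 0) → θ T = θ S)
    (hact : ∀ S T : Set Δ, T.Finite → S ⊆ T → (∀ δ ∈ T, δ ∉ S → f (θ T) δ < 0) → θ S = θ T)
    (d : ℕ) (hhel : ∀ T : Set Δ, T.Finite → ∃ S : Finset Δ, ↑S ⊆ T ∧ S.card ≤ d ∧ θ S = θ T)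
    (M : ℕ) (T : Set ℝ) (hT : MeasurableSet T) :
    (Measure.pi fun _ : Fin M => μ) {ω | okProb μ f (θ (Set.range ω)) ∈ T} =
      ∑ k ∈ Finset.range (d + 1), (M.choose k : ℝ≥0∞) *
        ∫⁻ t in T, ENNReal.ofReal t ^ (M - k) ∂(okLaw μ θ f k) := by
  classical
  have hok := measurable_okProb μ f hf
  have hm : MeasurableSet {ω : Fin M → Δ | okProb μ f (θ (Set.range ω)) ∈ T} :=
    (hok.comp (hθ M)) hT
  let c : Finset (Fin M) → ℝ≥0∞ := fun I => if I.card ≤ d then 1 else 0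
  have hae : ∀ᵐ ω ∂(Measure.pi fun _ : Fin M => μ),
      Set.indicator {ω : Fin M → Δ | okProb μ f (θ (Set.range ω)) ∈ T} (1 : (Fin M → Δ) → ℝ≥0∞) ω =
      ∑ I : Finset (Fin M), c I *
        Set.indicator (selSet θ f I ∩ {ω | okProb μ f (θ (ω '' I)) ∈ T}) (1 : (Fin M → Δ) → ℝ≥0∞) ω := by
    filter_upwards [ae_select μ θ f hf hθ hnull hfeas hloc hact d hhel M] with ω hω
    obtain ⟨I, hI1, hI2, hI3⟩ := hω
    rw [Finset.sum_eq_single I]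
    · simp only [c, hI1, if_true, one_mul]
      have hs : ω ∈ selSet θ f I := (hI3 I).2 rfl
      have : ω ∈ {ω : Fin M → Δ | okProb μ f (θ (Set.range ω)) ∈ T} ↔
          ω ∈ selSet θ f I ∩ {ω | okProb μ f (θ (ω '' I)) ∈ T} := by
        simp only [Set.mem_inter_iff, Set.mem_ofPred_eq, hI2, hs, true_and]
      by_cases h : ω ∈ {ω : Fin M → Δ | okProb μ f (θ (Set.range ω)) ∈ T}
      · rw [Set.indicator_of_mem h, Set.indicator_of_mem (this.1 h)]
      · rw [Set.indicator_of_notMem h, Set.indicator_of_notMem (fun h' => h (this.2 h'))]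
    · intro J _ hJ
      rw [Set.indicator_of_notMem, mul_zero]
      exact fun h => hJ ((hI3 J).1 h.1)
    · simp
  rw [← lintegral_indicator_one hm, lintegral_congr_ae hae, lintegral_finsetSum]
  · have h1 : ∀ I : Finset (Fin M), ∫⁻ ω, c I * Set.indicator
        (selSet θ f I ∩ {ω | okProb μ f (θ (ω '' I)) ∈ T}) (1 : (Fin M → Δ) → ℝ≥0∞) ω
          ∂(Measure.pi fun _ : Fin M => μ) =
        (fun k => (if k ≤ d then 1 else 0) *
          ∫⁻ t in T, ENNReal.ofReal t ^ (M - k) ∂(okLaw μ θ f k)) I.card := by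
      intro I
      have hms := measurableSet_sel μ θ f hf hθ I T hT
      rw [lintegral_const_mul _ (measurable_one.indicator hms), lintegral_indicator_one hms,
        sel_fubini μ θ f hf hθ I T hT]
    rw [Finset.sum_congr rfl (fun I _ => h1 I), ← Finset.powerset_univ,
      Finset.sum_powerset_apply_card (fun k => (if k ≤ d then 1 else 0) *
          ∫⁻ t in T, ENNReal.ofReal t ^ (M - k) ∂(okLaw μ θ f k)),
      Finset.card_univ, Fintype.card_fin]
    have h2 : ∀ k, M.choose k • ((if k ≤ d then 1 else 0) *
          ∫⁻ t in T, ENNReal.ofReal t ^ (M - k) ∂(okLaw μ θ f k)) =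
        if k ∈ Finset.range (d + 1) then (M.choose k : ℝ≥0∞) *
          ∫⁻ t in T, ENNReal.ofReal t ^ (M - k) ∂(okLaw μ θ f k) else 0 := by
      intro k
      simp only [Finset.mem_range, Nat.lt_succ_iff, nsmul_eq_mul]
      split_ifs <;> simp
    rw [Finset.sum_congr rfl (fun k _ => h2 k), ← Finset.sum_filter]
    apply Finset.sum_subset
    · intro k hk
      exact (Finset.mem_filter.1 hk).2
    · intro k hk hk'
      have : M < k := by
        by_contra hlt
        exact hk' (Finset.mem_filter.2 ⟨Finset.mem_range.2 (by omega), hk⟩)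
      rw [Nat.choose_eq_zero_of_lt this]
      simp
  · intro I _
    exact (measurable_one.indicator (measurableSet_sel μ θ f hf hθ I T hT)).const_mul _

theorem abstract_bound (μ : Measure Δ) [IsProbabilityMeasure μ] (θ : Set Δ → Θ) (f : Θ → Δ → ℝ)
    (hf : Measurable (fun p : Θ × Δ => f p.1 p.2))
    (hθ : ∀ k, Measurable (fun ω : Fin k → Δ => θ (Set.range ω)))
    (hnull : ∀ S : Set Δ, S.Finite → μ {δ | f (θ S) δ = 0} = 0)
    (hfeas : ∀ S : Set Δ, S.Finite → ∀ δ ∈ S, f (θ S) δ ≤ 0)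
    (hloc : ∀ S T : Set Δ, T.Finite → S ⊆ T → (∀ δ ∈ T, f (θ S) δ ≤ 0) → θ T = θ S)
    (hact : ∀ S T : Set Δ, T.Finite → S ⊆ T → (∀ δ ∈ T, δ ∉ S → f (θ T) δ < 0) → θ S = θ T)
    (d : ℕ) (hd : 1 ≤ d)
    (hhel : ∀ T : Set Δ, T.Finite → ∃ S : Finset Δ, ↑S ⊆ T ∧ S.card ≤ d ∧ θ S = θ T)
    (N : ℕ) (hN : d ≤ N) (ε : ℝ) (hε : ε ∈ Set.Ioo (0 : ℝ) 1) :
    (Measure.pi fun _ : Fin N => μ)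
      {ω | μ {δ | 0 < f (θ (Set.range ω)) δ} > ENNReal.ofReal ε} ≤
      ENNReal.ofReal (∑ j ∈ Finset.range d, (N.choose j : ℝ) * ε ^ j * (1 - ε) ^ (N - j)) := by
  have hok := measurable_okProb μ f hf
  have hfm : ∀ p, Measurable (f p) := fun p => hf.comp (measurable_const.prodMk measurable_id)
  have hset : {ω : Fin N → Δ | μ {δ | 0 < f (θ (Set.range ω)) δ} > ENNReal.ofReal ε} =
      {ω | okProb μ f (θ (Set.range ω)) ∈ Set.Iio (1 - ε)} := by
    ext ω
    simp only [Set.mem_ofPred_eq, Set.mem_Iio]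
    have hc : {δ | 0 < f (θ (Set.range ω)) δ} = {δ | f (θ (Set.range ω)) δ ≤ 0}ᶜ := by
      ext δ; simp
    have hms : MeasurableSet {δ | f (θ (Set.range ω)) δ ≤ 0} :=
      measurableSet_le (hfm _) measurable_const
    have hr : μ.real {δ | 0 < f (θ (Set.range ω)) δ} = 1 - okProb μ f (θ (Set.range ω)) := by
      rw [hc, probReal_compl_eq_one_sub hms, okProb]
    rw [gt_iff_lt, ← ofReal_measureReal, ENNReal.ofReal_lt_ofReal_iff_of_nonneg hε.1.le, hr]
    constructor <;> intro h <;> linarith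
  have hcm : ∀ k, Measurable (fun ω : Fin k → Δ => okProb μ f (θ (Set.range ω))) :=
    fun k => hok.comp (hθ k)
  have hfinite : ∀ k, IsFiniteMeasure (okLaw μ θ f k) := by
    intro k; unfold okLaw; infer_instance
  have hsupp : ∀ k, ∀ᵐ t ∂(okLaw μ θ f k), t ∈ Set.Icc (0 : ℝ) 1 := by
    intro k
    rw [okLaw]
    refine (ae_map_iff (hcm k).aemeasurable measurableSet_Icc).2 ?_
    exact Filter.Eventually.of_forall (fun ω => okProb_mem μ f _)
  have hInteg : ∀ (k j : ℕ) (T : Set ℝ), ∫⁻ t in T, ENNReal.ofReal t ^ j ∂(okLaw μ θ f k) =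
      ENNReal.ofReal (∫ t in T, t ^ j ∂(okLaw μ θ f k)) := by
    intro k j T
    have hs' : ∀ᵐ t ∂((okLaw μ θ f k).restrict T), t ∈ Set.Icc (0 : ℝ) 1 :=
      ae_restrict_of_ae (hsupp k)
    have hi : Integrable (fun t : ℝ => t ^ j) ((okLaw μ θ f k).restrict T) := by
      simpa using poly_integrable _ hs' (Polynomial.X ^ j)
    rw [ofReal_integral_eq_lintegral_ofReal hi]
    · apply lintegral_congr_ae
      filter_upwards [hs'] with t ht
      rw [ENNReal.ofReal_pow ht.1]
    · filter_upwards [hs'] with t ht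
      exact pow_nonneg ht.1 _
  have hnn : ∀ (k j : ℕ) (T : Set ℝ), 0 ≤ ∫ t in T, t ^ j ∂(okLaw μ θ f k) := by
    intro k j T
    apply integral_nonneg_of_ae
    filter_upwards [ae_restrict_of_ae (hsupp k)] with t ht
    exact pow_nonneg ht.1 _
  have hid : ∀ (M : ℕ) (T : Set ℝ), MeasurableSet T →
      (Measure.pi fun _ : Fin M => μ) {ω | okProb μ f (θ (Set.range ω)) ∈ T} =
      ENNReal.ofReal (∑ k ∈ Finset.range (d + 1), (M.choose k : ℝ) *
        ∫ t in T, t ^ (M - k) ∂(okLaw μ θ f k)) := by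
    intro M T hT
    rw [prob_identity μ θ f hf hθ hnull hfeas hloc hact d hhel M T hT,
      ENNReal.ofReal_sum_of_nonneg (fun k _ => mul_nonneg (Nat.cast_nonneg _) (hnn _ _ _))]
    apply Finset.sum_congr rfl
    intro k _
    rw [ENNReal.ofReal_mul (Nat.cast_nonneg _), hInteg, ENNReal.ofReal_natCast]
  rw [hset, hid N _ measurableSet_Iio]
  apply ENNReal.ofReal_le_ofReal
  obtain ⟨d, rfl⟩ : ∃ d', d = d' + 1 := ⟨d - 1, by omega⟩
  have := moment_bound d N hN (1 - ε) (by linarith [hε.2]) (by linarith [hε.1])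
    (okLaw μ θ f) hsupp (by
      intro M
      have h := hid M Set.univ MeasurableSet.univ
      have hu : {ω : Fin M → Δ | okProb μ f (θ (Set.range ω)) ∈ Set.univ} = Set.univ := by
        ext; simp
      rw [hu, measure_univ] at h
      simp only [Measure.restrict_univ] at h
      have h' := congrArg ENNReal.toReal h
      rw [ENNReal.toReal_ofReal] at h'
      · simpa using h'.symm
      · refine Finset.sum_nonneg (fun k _ => mul_nonneg (Nat.cast_nonneg _) ?_)
        simpa using hnn k (M - k) Set.univ)
  simpa using this

end ProbPart


section GenericPart

/-- Squared Frobenius norm. -/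
def jsq {n : ℕ} (P : Fin n → Fin n → ℝ) : ℝ := ∑ i, ∑ j, (P i j) ^ 2

lemma jsq_nonneg {n : ℕ} (P : Fin n → Fin n → ℝ) : 0 ≤ jsq P :=
  Finset.sum_nonneg fun _ _ => Finset.sum_nonneg fun _ _ => sq_nonneg _

lemma jsq_smul {n : ℕ} (c : ℝ) (P : Fin n → Fin n → ℝ) : jsq (c • P) = c ^ 2 * jsq P := by
  simp only [jsq, Finset.mul_sum, Pi.smul_apply, smul_eq_mul, mul_pow]

lemma jsq_comb {n : ℕ} (a b : ℝ) (hab : a + b = 1) (P Q : Fin n → Fin n → ℝ) :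
    jsq (a • P + b • Q) = a * jsq P + b * jsq Q - a * b * jsq (P - Q) := by
  simp only [jsq, Finset.mul_sum, ← Finset.sum_add_distrib, ← Finset.sum_sub_distrib]
  refine Finset.sum_congr rfl fun i _ => Finset.sum_congr rfl fun j _ => ?_
  simp only [Pi.add_apply, Pi.smul_apply, smul_eq_mul, Pi.sub_apply]
  have : b = 1 - a := by linarith
  subst this
  ring

lemma jsq_eq_zero {n : ℕ} {P : Fin n → Fin n → ℝ} (h : jsq P = 0) : P = 0 := by
  unfold jsq at h
  rw [Finset.sum_eq_zero_iff_of_nonneg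
    (fun _ _ => Finset.sum_nonneg fun _ _ => sq_nonneg _)] at h
  ext i j
  have h1 := h i (Finset.mem_univ _)
  rw [Finset.sum_eq_zero_iff_of_nonneg (fun _ _ => sq_nonneg _)] at h1
  simpa using h1 j (Finset.mem_univ _)

/-- The constraint function. -/
def jcon {n : ℕ} {Δ : Type*} (g h : Δ → (Fin n → Fin n → ℝ) →ₗ[ℝ] ℝ)
    (γ : ℝ) (P : Fin n → Fin n → ℝ) (δ : Δ) : ℝ := g δ P - γ ^ 2 * h δ P

/-- Feasibility. -/
def JFeas {n : ℕ} {Δ : Type*} (K : Set (Fin n → Fin n → ℝ))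
    (g h : Δ → (Fin n → Fin n → ℝ) →ₗ[ℝ] ℝ) (S : Set Δ) (γ : ℝ)
    (P : Fin n → Fin n → ℝ) : Prop :=
  0 ≤ γ ∧ P ∈ K ∧ ∀ δ ∈ S, jcon g h γ P δ ≤ 0

/-- Abstract data of the sampled quasi-convex problem. -/
structure JSetup (n : ℕ) (Δ : Type*) where
  K : Set (Fin n → Fin n → ℝ)
  g : Δ → (Fin n → Fin n → ℝ) →ₗ[ℝ] ℝ
  h : Δ → (Fin n → Fin n → ℝ) →ₗ[ℝ] ℝ
  conv : Convex ℝ K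
  symm : ∀ P ∈ K, ∀ i j, P i j = P j i
  tr : ∀ P ∈ K, 0 < ∑ i, P i i
  gnn : ∀ δ, ∀ P ∈ K, 0 ≤ g δ P
  hpos : ∀ δ, ∀ P ∈ K, 0 < h δ P
  θ : Set Δ → ℝ × (Fin n → Fin n → ℝ)
  feas : ∀ S : Set Δ, S.Finite → JFeas K g h S (θ S).1 (θ S).2
  opt : ∀ S : Set Δ, S.Finite → ∀ γ P, JFeas K g h S γ P →
    (θ S).1 < γ ∨ ((θ S).1 = γ ∧ jsq (θ S).2 ≤ jsq P)

lemma jcon_comb {n : ℕ} {Δ : Type*} (g h : Δ → (Fin n → Fin n → ℝ) →ₗ[ℝ] ℝ)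
    (γ a b : ℝ) (P Q : Fin n → Fin n → ℝ) (δ : Δ) :
    jcon g h γ (a • P + b • Q) δ = a * jcon g h γ P δ + b * jcon g h γ Q δ := by
  simp only [jcon, map_add, map_smul, smul_eq_mul]
  ring

lemma jcon_smul {n : ℕ} {Δ : Type*} (g h : Δ → (Fin n → Fin n → ℝ) →ₗ[ℝ] ℝ)
    (γ a : ℝ) (P : Fin n → Fin n → ℝ) (δ : Δ) :
    jcon g h γ (a • P) δ = a * jcon g h γ P δ := by
  simp only [jcon, map_smul, smul_eq_mul]
  ring

lemma JFeas.mono {n : ℕ} {Δ : Type*} {K : Set (Fin n → Fin n → ℝ)}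
    {g h : Δ → (Fin n → Fin n → ℝ) →ₗ[ℝ] ℝ} {S T : Set Δ} (hST : S ⊆ T) {γ : ℝ}
    {P : Fin n → Fin n → ℝ} (hF : JFeas K g h T γ P) : JFeas K g h S γ P :=
  ⟨hF.1, hF.2.1, fun δ hδ => hF.2.2 δ (hST hδ)⟩

namespace JSetup

variable {n : ℕ} {Δ : Type*} (D : JSetup n Δ)

lemma uniq (S : Set Δ) (hS : S.Finite) (p : ℝ × (Fin n → Fin n → ℝ))
    (hp : JFeas D.K D.g D.h S p.1 p.2) (h1 : p.1 = (D.θ S).1)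
    (h2 : jsq p.2 ≤ jsq (D.θ S).2) : p = D.θ S := by
  have hf := D.feas S hS
  rw [h1] at hp
  refine Prod.ext h1 ?_
  have hm : JFeas D.K D.g D.h S (D.θ S).1 ((1 / 2 : ℝ) • p.2 + (1 / 2 : ℝ) • (D.θ S).2) := by
    refine ⟨hf.1, D.conv hp.2.1 hf.2.1 (by norm_num) (by norm_num) (by norm_num), ?_⟩
    intro δ hδ
    rw [jcon_comb]
    linarith [hp.2.2 δ hδ, hf.2.2 δ hδ]
  rcases D.opt S hS _ _ hm with h | ⟨_, h⟩
  · exact absurd h (lt_irrefl _)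
  · rw [jsq_comb _ _ (by norm_num)] at h
    have h0 := jsq_nonneg (p.2 - (D.θ S).2)
    have := jsq_eq_zero (P := p.2 - (D.θ S).2) (by linarith)
    exact sub_eq_zero.1 this

lemma loc (S T : Set Δ) (hT : T.Finite) (hST : S ⊆ T)
    (h : ∀ δ ∈ T, jcon D.g D.h (D.θ S).1 (D.θ S).2 δ ≤ 0) : D.θ T = D.θ S := by
  have hS := hT.subset hST
  have fS := D.feas S hS
  have fT := D.feas T hT
  have fST : JFeas D.K D.g D.h T (D.θ S).1 (D.θ S).2 := ⟨fS.1, fS.2.1, h⟩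
  refine D.uniq S hS _ (fT.mono hST) ?_ ?_ <;>
  rcases D.opt T hT _ _ fST with h1 | ⟨h1, h2⟩ <;>
  rcases D.opt S hS _ _ (fT.mono hST) with h3 | ⟨h3, h4⟩ <;> linarith

lemma reduce (T : Set Δ) (hT : T.Finite) (γ : ℝ) (hγ : 0 ≤ γ) (P : Fin n → Fin n → ℝ)
    (hP : P ∈ D.K) (hne : T.Nonempty) (h : ∀ δ ∈ T, jcon D.g D.h γ P δ < 0) :
    ∃ γ', γ' < γ ∧ JFeas D.K D.g D.h T γ' P := by
  have hγ0 : 0 < γ := by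
    obtain ⟨δ, hδ⟩ := hne
    have h1 := h δ hδ
    have h2 := D.gnn δ P hP
    rcases hγ.eq_or_lt with h3 | h3
    · subst h3; simp only [jcon] at h1; norm_num at h1; linarith
    · exact h3
  have hc : ∀ δ ∈ T, ∀ᶠ s in nhds γ, jcon D.g D.h s P δ < 0 := by
    intro δ hδ
    have : Continuous fun s : ℝ => jcon D.g D.h s P δ := by unfold jcon; fun_prop
    exact this.continuousAt.eventually (gt_mem_nhds (h δ hδ))
  have h1 := (Filter.eventually_all_finite hT).2 hc
  have h2 := ((h1.and (lt_mem_nhds hγ0)).filter_mono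
    (nhdsWithin_le_nhds (s := Set.Iio γ))).and self_mem_nhdsWithin
  obtain ⟨s, ⟨h3, h4⟩, h5⟩ := h2.exists
  exact ⟨s, h5, h4.le, hP, fun δ hδ => (h3 δ hδ).le⟩

lemma act (S T : Set Δ) (hT : T.Finite) (hST : S ⊆ T)
    (h : ∀ δ ∈ T, δ ∉ S → jcon D.g D.h (D.θ T).1 (D.θ T).2 δ < 0) : D.θ S = D.θ T := by
  have hS := hT.subset hST
  have fS := D.feas S hS
  have fT := D.feas T hT
  have hco : ∀ δ ∈ T, δ ∉ S → ∀ᶠ t in nhds (0 : ℝ),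
      jcon D.g D.h (D.θ T).1 ((1 - t) • (D.θ T).2 + t • (D.θ S).2) δ < 0 := by
    intro δ hδ hδ'
    have hc : Continuous fun t : ℝ =>
        jcon D.g D.h (D.θ T).1 ((1 - t) • (D.θ T).2 + t • (D.θ S).2) δ := by
      simp only [jcon_comb]; fun_prop
    refine hc.continuousAt.eventually (gt_mem_nhds ?_)
    simpa using h δ hδ hδ'
  have h1 : ∀ᶠ t in nhds (0 : ℝ), ∀ δ ∈ T, δ ∉ S →
      jcon D.g D.h (D.θ T).1 ((1 - t) • (D.θ T).2 + t • (D.θ S).2) δ < 0 := by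
    refine (Filter.eventually_all_finite hT).2 fun δ hδ => ?_
    by_cases h' : δ ∈ S
    · exact Filter.Eventually.of_forall fun t ht => absurd h' ht
    · filter_upwards [hco δ hδ h'] with t ht _ using ht
  have h2 := ((h1.and (gt_mem_nhds (zero_lt_one))).filter_mono
    (nhdsWithin_le_nhds (s := Set.Ioi (0 : ℝ)))).and self_mem_nhdsWithin
  obtain ⟨t, ⟨h3, h4⟩, h5⟩ := h2.exists
  replace h5 : 0 < t := h5
  have hK : (1 - t) • (D.θ T).2 + t • (D.θ S).2 ∈ D.K :=
    D.conv fT.2.1 fS.2.1 (by linarith) h5.le (by ring)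
  symm
  rcases D.opt S hS _ _ (fT.mono hST) with h6 | ⟨h6, h7⟩
  · exfalso
    have hsm : ∀ δ ∈ S, jcon D.g D.h (D.θ T).1 (D.θ S).2 δ < 0 := by
      intro δ hδ
      have a1 := fS.2.2 δ hδ
      have a2 := D.hpos δ _ fS.2.1
      have a3 : (D.θ S).1 ^ 2 < (D.θ T).1 ^ 2 := by
        have := fS.1
        nlinarith
      simp only [jcon] at a1 ⊢
      nlinarith
    by_cases hne : T.Nonempty
    · obtain ⟨γ', b1, b2⟩ := D.reduce T hT (D.θ T).1 fT.1 _ hK hne (by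
        intro δ hδ
        by_cases h' : δ ∈ S
        · rw [jcon_comb]
          have := fT.2.2 δ hδ
          have := hsm δ h'
          nlinarith
        · exact h3 δ hδ h')
      rcases D.opt T hT _ _ b2 with c | ⟨c, _⟩ <;> linarith
    · have : T = ∅ := Set.not_nonempty_iff_eq_empty.1 hne
      have : S = T := by
        subst this; exact Set.subset_empty_iff.1 hST
      rw [this] at h6
      exact lt_irrefl _ h6
  · refine D.uniq S hS _ (fT.mono hST) h6.symm ?_
    by_contra hlt
    push Not at hlt
    have b2 : JFeas D.K D.g D.h T (D.θ T).1 ((1 - t) • (D.θ T).2 + t • (D.θ S).2) := by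
      refine ⟨fT.1, hK, fun δ hδ => ?_⟩
      by_cases h' : δ ∈ S
      · rw [jcon_comb]
        have := fT.2.2 δ hδ
        have := fS.2.2 δ h'
        rw [h6] at this
        nlinarith
      · exact (h3 δ hδ h').le
    rcases D.opt T hT _ _ b2 with c | ⟨_, c⟩
    · exact lt_irrefl _ c
    · rw [jsq_comb _ _ (by ring)] at c
      have := jsq_nonneg ((D.θ T).2 - (D.θ S).2)
      have : 0 ≤ (1 - t) * t * jsq ((D.θ T).2 - (D.θ S).2) := by
        have : 0 ≤ 1 - t := by linarith
        positivity
      nlinarith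

end JSetup


/-- Symmetric matrices from functions on unordered pairs. -/
def symLift (n : ℕ) : (Sym2 (Fin n) → ℝ) →ₗ[ℝ] (Fin n → Fin n → ℝ) where
  toFun v := fun i j => v s(i, j)
  map_add' _ _ := rfl
  map_smul' _ _ := rfl

/-- The trace functional on functions on unordered pairs. -/
def symTr (n : ℕ) : (Sym2 (Fin n) → ℝ) →ₗ[ℝ] ℝ where
  toFun v := ∑ i, v s(i, i)
  map_add' _ _ := by simp [Finset.sum_add_distrib]
  map_smul' _ _ := by simp [Finset.mul_sum]

lemma symTr_finrank (n : ℕ) (hn : 1 ≤ n) :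
    Module.finrank ℝ (LinearMap.ker (symTr n)) + 1 = n * (n + 1) / 2 := by
  have h : symTr n ≠ 0 := by
    intro h
    have := congrArg (fun f => f (fun _ => (1 : ℝ))) h
    simp [symTr] at this
    omega
  have := Module.Dual.finrank_ker_add_one_of_ne_zero (f := symTr n) h
  rw [this, Module.finrank_fintype_fun_eq_card, Sym2.card, Fintype.card_fin, Nat.choose_two_right]
  simp [mul_comm]

namespace JSetup

variable {n : ℕ} {Δ : Type*} (D : JSetup n Δ)

/-- Matrices strictly improving at one constraint. -/
def X (γ r : ℝ) (δ : Δ) : Set (Fin n → Fin n → ℝ) :=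
  {P | P ∈ D.K ∧ (jcon D.g D.h γ P δ < 0 ∨ (jcon D.g D.h γ P δ = 0 ∧ jsq P < r))}

lemma X_comb (γ r : ℝ) (δ : Δ) {P Q : Fin n → Fin n → ℝ} (hP : P ∈ D.X γ r δ)
    (hQ : Q ∈ D.X γ r δ) {a b : ℝ} (ha : 0 < a) (hb : 0 < b) (hab : a + b = 1) :
    a • P + b • Q ∈ D.X γ r δ := by
  refine ⟨D.conv hP.1 hQ.1 ha.le hb.le hab, ?_⟩
  rw [jcon_comb, jsq_comb _ _ hab]
  have h0 : 0 ≤ a * b * jsq (P - Q) := by have := jsq_nonneg (P - Q); positivity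
  rcases hP.2 with h1 | ⟨h1, h1'⟩ <;> rcases hQ.2 with h2 | ⟨h2, h2'⟩
  · left; nlinarith
  · left; nlinarith
  · left; nlinarith
  · right
    refine ⟨by rw [h1, h2]; ring, ?_⟩
    have : r = a * r + b * r := by rw [← add_mul, hab, one_mul]
    nlinarith

/-- Normalised matrix. -/
def nmat (w : LinearMap.ker (symTr n)) : Fin n → Fin n → ℝ :=
  symLift n w + fun i j => if i = j then 1 else 0

lemma nmat_comb (w v : LinearMap.ker (symTr n)) (a b : ℝ) (hab : a + b = 1) :
    nmat (a • w + b • v) = a • nmat w + b • nmat v := by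
  have : b = 1 - a := by linarith
  subst this
  ext i j
  simp only [nmat, Submodule.coe_add, Submodule.coe_smul, map_add, map_smul, Pi.add_apply,
    Pi.smul_apply, smul_eq_mul]
  ring

/-- Cone sections. -/
def Y (γ r : ℝ) (δ : Δ) : Set (LinearMap.ker (symTr n)) :=
  {w | ∃ s : ℝ, 0 < s ∧ s • nmat w ∈ D.X γ r δ}

lemma Y_convex (γ r : ℝ) (δ : Δ) : Convex ℝ (D.Y γ r δ) := by
  rw [convex_iff_forall_pos]
  rintro w ⟨s, hs, hw⟩ v ⟨u, hu, hv⟩ a b ha hb hab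
  have hpos : 0 < a / s + b / u := by positivity
  refine ⟨1 / (a / s + b / u), by positivity, ?_⟩
  have := D.X_comb γ r δ hw hv (a := a / s / (a / s + b / u)) (b := b / u / (a / s + b / u))
    (by positivity) (by positivity) (by field_simp)
  convert this using 1
  rw [nmat_comb _ _ _ _ hab, smul_add, smul_smul, smul_smul, smul_smul, smul_smul]
  congr 2 <;> field_simp

lemma X_inter (T : Set Δ) (hT : T.Finite) (hne : T.Nonempty) :
    ¬ ∃ P, ∀ δ ∈ T, P ∈ D.X (D.θ T).1 (jsq (D.θ T).2) δ := by
  rintro ⟨P, hP⟩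
  have fT := D.feas T hT
  obtain ⟨δ0, hδ0⟩ := hne
  have hK : P ∈ D.K := (hP δ0 hδ0).1
  by_cases h : jsq P < jsq (D.θ T).2
  · have : JFeas D.K D.g D.h T (D.θ T).1 P := by
      refine ⟨fT.1, hK, fun δ hδ => ?_⟩
      rcases (hP δ hδ).2 with h1 | ⟨h1, _⟩
      · exact h1.le
      · exact h1.le
    rcases D.opt T hT _ _ this with c | ⟨_, c⟩ <;> linarith
  · obtain ⟨γ', b1, b2⟩ := D.reduce T hT (D.θ T).1 fT.1 P hK ⟨δ0, hδ0⟩ (by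
      intro δ hδ
      rcases (hP δ hδ).2 with h1 | ⟨_, h1⟩
      · exact h1
      · exact absurd h1 h)
    rcases D.opt T hT _ _ b2 with c | ⟨c, _⟩ <;> linarith

lemma Y_inter (T : Set Δ) (hT : T.Finite) (hne : T.Nonempty) :
    ¬ ∃ w, ∀ δ ∈ T, w ∈ D.Y (D.θ T).1 (jsq (D.θ T).2) δ := by
  rintro ⟨w, hw⟩
  have hw' : ∀ δ, ∃ s : ℝ, δ ∈ T → 0 < s ∧ s • nmat w ∈ D.X (D.θ T).1 (jsq (D.θ T).2) δ := by
    intro δ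
    by_cases h : δ ∈ T
    · obtain ⟨s, hs⟩ := hw δ h
      exact ⟨s, fun _ => hs⟩
    · exact ⟨0, fun h' => absurd h' h⟩
  choose s hs using hw'
  obtain ⟨δ0, hδ0, hmin⟩ := Set.exists_min_image T s hT hne
  refine D.X_inter T hT hne ⟨s δ0 • nmat w, fun δ hδ => ?_⟩
  obtain ⟨p0, q0⟩ := hs δ0 hδ0
  obtain ⟨p, q⟩ := hs δ hδ
  refine ⟨q0.1, ?_⟩
  have hle := hmin δ hδ
  have hq := q.2
  rw [jcon_smul, jsq_smul] at hq ⊢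
  rcases hq with h | ⟨h, h'⟩
  · left
    have : jcon D.g D.h (D.θ T).1 (nmat w) δ < 0 := by
      by_contra hc
      push Not at hc
      have := mul_nonneg p.le hc
      linarith
    nlinarith
  · right
    have : jcon D.g D.h (D.θ T).1 (nmat w) δ = 0 := by
      rcases mul_eq_zero.1 h with h | h
      · exact absurd h p.ne'
      · exact h
    refine ⟨by rw [this, mul_zero], lt_of_le_of_lt ?_ h'⟩
    have := jsq_nonneg (nmat w)
    gcongr

lemma X_to_Y (γ r : ℝ) (I : Set Δ) (P : Fin n → Fin n → ℝ) (hK : P ∈ D.K)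
    (hP : ∀ δ ∈ I, P ∈ D.X γ r δ) : ∃ w, ∀ δ ∈ I, w ∈ D.Y γ r δ := by
  have htr := D.tr P hK
  have hsy := D.symm P hK
  set t := ∑ i, P i i with ht
  have hn0 : (0 : ℝ) < n := by
    rcases Nat.eq_zero_or_pos n with h | h
    · subst h; simp [ht] at htr
    · exact_mod_cast h
  let v : Sym2 (Fin n) → ℝ := fun z =>
    Sym2.lift ⟨fun i j => (n / t) * P i j - if i = j then 1 else 0, by
      intro i j; beta_reduce; rw [hsy i j]; simp [eq_comm]⟩ z
  have hv : v ∈ LinearMap.ker (symTr n) := by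
    rw [LinearMap.mem_ker]
    simp only [symTr, LinearMap.coe_mk, AddHom.coe_mk, v, Sym2.lift_mk]
    simp only [if_true, Finset.sum_sub_distrib, ← Finset.mul_sum, ← ht]
    simp
    field_simp
    simp
  refine ⟨⟨v, hv⟩, fun δ hδ => ⟨t / n, by positivity, ?_⟩⟩
  convert hP δ hδ using 1
  ext i j
  simp only [nmat, symLift, LinearMap.coe_mk, AddHom.coe_mk, v, Sym2.lift_mk, Pi.smul_apply,
    Pi.add_apply, smul_eq_mul]
  field_simp
  ring

lemma helly (hn : 1 ≤ n) (T : Set Δ) (hT : T.Finite) :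
    ∃ S : Finset Δ, (S : Set Δ) ⊆ T ∧ S.card ≤ n * (n + 1) / 2 ∧ D.θ S = D.θ T := by
  classical
  rcases T.eq_empty_or_nonempty with rfl | hne
  · exact ⟨∅, by simp, by simp, by simp⟩
  have h1 := D.Y_inter T hT hne
  obtain ⟨I, hI, hcard, hemp⟩ : ∃ I : Finset Δ, I ⊆ hT.toFinset ∧
      I.card ≤ n * (n + 1) / 2 ∧ ¬ (⋂ i ∈ I, D.Y (D.θ T).1 (jsq (D.θ T).2) i).Nonempty := by
    by_contra hcon
    push Not at hcon
    have := Convex.helly_theorem' (𝕜 := ℝ) (F := D.Y (D.θ T).1 (jsq (D.θ T).2)) (s := hT.toFinset)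
      (fun i _ => D.Y_convex _ _ i) (fun I hI hc => hcon I hI (by
        rw [symTr_finrank n hn] at hc; exact hc))
    obtain ⟨w, hw⟩ := this
    refine h1 ⟨w, fun δ hδ => ?_⟩
    simp only [Set.mem_iInter] at hw
    exact hw δ (by simpa using hδ)
  have hIT : (I : Set Δ) ⊆ T := fun x hx => by simpa using hI hx
  refine ⟨I, hIT, hcard, ?_⟩
  have fI := D.feas I I.finite_toSet
  have fT := D.feas T hT
  have hno : ¬ ∃ w, ∀ δ ∈ (I : Set Δ), w ∈ D.Y (D.θ T).1 (jsq (D.θ T).2) δ := by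
    rintro ⟨w, hw⟩
    exact hemp ⟨w, by simpa using hw⟩
  symm
  rcases D.opt I I.finite_toSet _ _ (fT.mono hIT) with h6 | ⟨h6, h7⟩
  · exfalso
    refine hno (D.X_to_Y _ _ _ _ fI.2.1 fun δ hδ => ⟨fI.2.1, Or.inl ?_⟩)
    have a1 := fI.2.2 δ hδ
    have a2 := D.hpos δ _ fI.2.1
    have a3 : (D.θ I).1 ^ 2 < (D.θ T).1 ^ 2 := by
      have := fI.1
      nlinarith
    simp only [jcon] at a1 ⊢
    nlinarith
  · refine D.uniq I I.finite_toSet _ (fT.mono hIT) h6.symm ?_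
    by_contra hlt
    push Not at hlt
    refine hno (D.X_to_Y _ _ _ _ fI.2.1 fun δ hδ => ⟨fI.2.1, ?_⟩)
    have a1 := fI.2.2 δ hδ
    rw [h6] at a1
    rcases a1.lt_or_eq with a | a
    · exact Or.inl a
    · exact Or.inr ⟨a, hlt⟩

end JSetup


lemma jsq_continuous {n : ℕ} : Continuous (jsq : (Fin n → Fin n → ℝ) → ℝ) := by
  unfold jsq; fun_prop

namespace JSetup

variable {n : ℕ} {Δ : Type*} [TopologicalSpace Δ] (D : JSetup n Δ)

/-- Parametrised feasibility region. -/
def R (k : ℕ) (F : Set (Fin n → Fin n → ℝ)) : Set (ℝ × ℝ × (Fin k → Δ)) :=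
  {q | ∃ P ∈ D.K, P ∈ F ∧ (∀ i, jcon D.g D.h q.1 P (q.2.2 i) ≤ 0) ∧ jsq P ≤ q.2.1}

lemma R_closed (k : ℕ) (F : Set (Fin n → Fin n → ℝ)) (hF : IsClosed F) (hK : IsCompact D.K)
    (hc : Continuous fun p : ℝ × (Fin n → Fin n → ℝ) × Δ => jcon D.g D.h p.1 p.2.1 p.2.2) :
    IsClosed (D.R k F) := by
  have : CompactSpace D.K := isCompact_iff_compactSpace.1 hK
  let Z : Set (D.K × (ℝ × ℝ × (Fin k → Δ))) :=
    {z | (z.1 : Fin n → Fin n → ℝ) ∈ F} ∩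
      ({z | ∀ i, jcon D.g D.h z.2.1 z.1 (z.2.2.2 i) ≤ 0} ∩ {z | jsq (z.1 : Fin n → Fin n → ℝ) ≤ z.2.2.1})
  have hZ : IsClosed Z := by
    refine IsClosed.inter (hF.preimage (by fun_prop)) (IsClosed.inter ?_ ?_)
    · have : {z : D.K × (ℝ × ℝ × (Fin k → Δ)) | ∀ i, jcon D.g D.h z.2.1 z.1 (z.2.2.2 i) ≤ 0}
          = ⋂ i, {z | jcon D.g D.h z.2.1 z.1 (z.2.2.2 i) ≤ 0} := by
        ext; simp
      rw [this]
      refine isClosed_iInter fun i => isClosed_le ?_ continuous_const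
      exact hc.comp (by fun_prop : Continuous fun z : D.K × (ℝ × ℝ × (Fin k → Δ)) =>
        (z.2.1, (z.1 : Fin n → Fin n → ℝ), z.2.2.2 i))
    · exact isClosed_le (jsq_continuous.comp (by fun_prop)) (by fun_prop)
  have := (isClosedMap_snd_of_compactSpace (X := D.K) (Y := ℝ × ℝ × (Fin k → Δ))) Z hZ
  convert this using 1
  ext q
  constructor
  · rintro ⟨P, h1, h2, h3, h4⟩
    exact ⟨(⟨P, h1⟩, q), ⟨h2, h3, h4⟩, rfl⟩
  · rintro ⟨⟨P, q'⟩, ⟨h2, h3, h4⟩, rfl⟩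
    exact ⟨P, P.2, h2, h3, h4⟩

lemma meas_theta [MeasurableSpace Δ] (k : ℕ) [BorelSpace (Fin k → Δ)] (B : ℝ)
    (hB : ∀ P ∈ D.K, jsq P ≤ B) (hK : IsCompact D.K)
    (hc : Continuous fun p : ℝ × (Fin n → Fin n → ℝ) × Δ => jcon D.g D.h p.1 p.2.1 p.2.2) :
    Measurable (fun ω : Fin k → Δ => D.θ (Set.range ω)) := by
  have hfin : ∀ ω : Fin k → Δ, (Set.range ω).Finite := fun ω => Set.finite_range ω
  have hRm : ∀ F, IsClosed F → MeasurableSet (D.R k F) := fun F hF =>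
    (D.R_closed k F hF hK hc).measurableSet
  have hfeas : ∀ (ω : Fin k → Δ) i, jcon D.g D.h (D.θ (Set.range ω)).1 (D.θ (Set.range ω)).2 (ω i)
      ≤ 0 := fun ω i => (D.feas _ (hfin ω)).2.2 _ ⟨i, rfl⟩
  have m1 : Measurable (fun ω : Fin k → Δ => (D.θ (Set.range ω)).1) := by
    refine measurable_of_Iic fun c => ?_
    by_cases h0 : 0 ≤ c
    · have : (fun ω : Fin k → Δ => (D.θ (Set.range ω)).1) ⁻¹' Set.Iic c =
          (fun ω => (c, B, ω)) ⁻¹' D.R k Set.univ := by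
        ext ω
        have fT := D.feas _ (hfin ω)
        simp only [Set.mem_preimage, Set.mem_Iic]
        constructor
        · intro h
          refine ⟨(D.θ (Set.range ω)).2, fT.2.1, trivial, fun i => ?_, hB _ fT.2.1⟩
          have a1 := hfeas ω i
          have a2 := D.hpos (ω i) _ fT.2.1
          have a3 : (D.θ (Set.range ω)).1 ^ 2 ≤ c ^ 2 := by
            have := fT.1
            nlinarith
          simp only [jcon] at a1 ⊢
          nlinarith
        · rintro ⟨P, h1, _, h3, _⟩
          rcases D.opt _ (hfin ω) c P ⟨h0, h1, by rintro _ ⟨i, rfl⟩; exact h3 i⟩ with a | ⟨a, _⟩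
          · exact a.le
          · exact a.le
      rw [this]
      exact (by fun_prop : Measurable fun ω : Fin k → Δ => (c, B, ω)) (hRm _ isClosed_univ)
    · convert MeasurableSet.empty
      ext ω
      simp only [Set.mem_preimage, Set.mem_Iic, Set.mem_empty_iff_false, iff_false]
      have := (D.feas _ (hfin ω)).1
      intro h
      linarith
  have m2 : Measurable (fun ω : Fin k → Δ => jsq (D.θ (Set.range ω)).2) := by
    refine measurable_of_Iic fun c => ?_
    have : (fun ω : Fin k → Δ => jsq (D.θ (Set.range ω)).2) ⁻¹' Set.Iic c =
        (fun ω => ((D.θ (Set.range ω)).1, c, ω)) ⁻¹' D.R k Set.univ := by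
      ext ω
      have fT := D.feas _ (hfin ω)
      simp only [Set.mem_preimage, Set.mem_Iic]
      constructor
      · intro h
        exact ⟨_, fT.2.1, trivial, hfeas ω, h⟩
      · rintro ⟨P, h1, _, h3, h4⟩
        rcases D.opt _ (hfin ω) _ P ⟨fT.1, h1, by rintro _ ⟨i, rfl⟩; exact h3 i⟩ with a | ⟨_, a⟩
        · exact absurd a (lt_irrefl _)
        · exact a.trans h4
    rw [this]
    exact (m1.prodMk (measurable_const.prodMk measurable_id)) (hRm _ isClosed_univ)
  have m3 : Measurable (fun ω : Fin k → Δ => (D.θ (Set.range ω)).2) := by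
    refine measurable_of_isClosed fun F hF => ?_
    have : (fun ω : Fin k → Δ => (D.θ (Set.range ω)).2) ⁻¹' F =
        (fun ω => ((D.θ (Set.range ω)).1, jsq (D.θ (Set.range ω)).2, ω)) ⁻¹' D.R k F := by
      ext ω
      have fT := D.feas _ (hfin ω)
      simp only [Set.mem_preimage]
      constructor
      · intro h
        exact ⟨_, fT.2.1, h, hfeas ω, le_rfl⟩
      · rintro ⟨P, h1, h2, h3, h4⟩
        have := D.uniq _ (hfin ω) ((D.θ (Set.range ω)).1, P)
          ⟨fT.1, h1, by rintro _ ⟨i, rfl⟩; exact h3 i⟩ rfl h4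
        rw [← this]
        exact h2
    rw [this]
    exact (m1.prodMk (m2.prodMk measurable_id)) (hRm _ hF)
  exact m1.prodMk m3

end JSetup

end GenericPart


section ConcretePart

lemma quadForm_eq {n : ℕ} (P : Matrix (Fin n) (Fin n) ℝ) (x : Fin n → ℝ) :
    quadForm P x = x ⬝ᵥ P *ᵥ x := by
  simp only [quadForm, dotProduct, mulVec, Finset.mul_sum, mul_assoc]

/-- The quadratic form as a linear function of the matrix. -/
def qfLin {n : ℕ} (x : Fin n → ℝ) : (Fin n → Fin n → ℝ) →ₗ[ℝ] ℝ where
  toFun P := quadForm P x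
  map_add' P Q := by
    simp only [quadForm, ← Finset.sum_add_distrib, Pi.add_apply]
    refine Finset.sum_congr rfl fun i _ => Finset.sum_congr rfl fun j _ => by ring
  map_smul' c P := by
    simp only [quadForm, Finset.mul_sum, Pi.smul_apply, smul_eq_mul, RingHom.id_apply]
    refine Finset.sum_congr rfl fun i _ => Finset.sum_congr rfl fun j _ => by ring

lemma qfLin_apply {n : ℕ} (x : Fin n → ℝ) (P : Fin n → Fin n → ℝ) :
    qfLin x P = quadForm P x := rfl

/-- The compact convex set of admissible matrices. -/
def JK (n : ℕ) (C : ℝ) : Set (Fin n → Fin n → ℝ) :=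
  {P | (∀ i j, P i j = P j i) ∧ (∀ x : Fin n → ℝ, ∑ i, x i ^ 2 ≤ quadForm P x) ∧ jsq P ≤ C ^ 2}

lemma JK_iff {n : ℕ} {C : ℝ} (hC : 0 ≤ C) (P : Matrix (Fin n) (Fin n) ℝ) :
    (P.IsSymm ∧ (P - 1).PosSemidef ∧ frobNorm P ≤ C) ↔ P ∈ JK n C := by
  have h1 : P.IsSymm ↔ ∀ i j, P i j = P j i := by
    constructor
    · intro h i j
      exact h.apply j i
    · intro h
      ext i j
      exact h j i
  have h2 : frobNorm P ≤ C ↔ jsq P ≤ C ^ 2 := by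
    unfold frobNorm
    rw [Real.sqrt_le_left hC]
    rfl
  have h3 : ∀ x : Fin n → ℝ, x ⬝ᵥ (P - 1) *ᵥ x = quadForm P x - ∑ i, x i ^ 2 := by
    intro x
    rw [quadForm_eq, Matrix.sub_mulVec, dotProduct_sub, Matrix.one_mulVec]
    congr 1
    simp [dotProduct, sq]
  constructor
  · rintro ⟨a, b, c⟩
    refine ⟨h1.1 a, fun x => ?_, h2.1 c⟩
    have := (Matrix.posSemidef_iff_dotProduct_mulVec.1 b).2 x
    rw [star_trivial, h3] at this
    linarith
  · rintro ⟨a, b, c⟩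
    refine ⟨h1.2 a, ?_, h2.2 c⟩
    rw [Matrix.posSemidef_iff_dotProduct_mulVec]
    refine ⟨?_, fun x => ?_⟩
    · have : P.IsHermitian := by
        rw [Matrix.IsHermitian, Matrix.conjTranspose_eq_transpose_of_trivial]; exact h1.2 a
      exact this.sub Matrix.isHermitian_one
    · rw [star_trivial, h3]
      linarith [b x]

lemma frobNorm_sq {n : ℕ} (P : Matrix (Fin n) (Fin n) ℝ) : frobNorm P ^ 2 = jsq P := by
  exact Real.sq_sqrt (jsq_nonneg P)

lemma JK_convex (n : ℕ) (C : ℝ) : Convex ℝ (JK n C) := by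
  intro P hP Q hQ a b ha hb hab
  refine ⟨fun i j => ?_, fun x => ?_, ?_⟩
  · simp only [Pi.add_apply, Pi.smul_apply, hP.1 i j, hQ.1 i j]
  · have h := (qfLin x).map_add (a • P) (b • Q)
    rw [map_smul, map_smul, qfLin_apply, qfLin_apply, qfLin_apply, smul_eq_mul, smul_eq_mul] at h
    rw [h]
    have h1 := hP.2.1 x
    have h2 := hQ.2.1 x
    have : ∑ i, x i ^ 2 = a * ∑ i, x i ^ 2 + b * ∑ i, x i ^ 2 := by rw [← add_mul, hab, one_mul]
    rw [this]
    gcongr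
  · rw [jsq_comb _ _ hab]
    have := mul_nonneg (mul_nonneg ha hb) (jsq_nonneg (P - Q))
    have h1 := hP.2.2
    have h2 := hQ.2.2
    have : C ^ 2 = a * C ^ 2 + b * C ^ 2 := by rw [← add_mul, hab, one_mul]
    nlinarith

lemma quadForm_continuous (n : ℕ) :
    Continuous fun p : (Fin n → Fin n → ℝ) × (Fin n → ℝ) => quadForm p.1 p.2 := by
  unfold quadForm
  fun_prop

lemma JK_compact (n : ℕ) (C : ℝ) : IsCompact (JK n C) := by
  refine Metric.isCompact_of_isClosed_isBounded ?_ ?_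
  · have : JK n C = {P | ∀ i j, P i j = P j i} ∩ ({P | ∀ x : Fin n → ℝ, ∑ i, x i ^ 2 ≤ quadForm P x}
        ∩ {P | jsq P ≤ C ^ 2}) := rfl
    rw [this]
    refine IsClosed.inter ?_ (IsClosed.inter ?_ ?_)
    · simp only [Set.ofPred_forall]
      exact isClosed_iInter fun i => isClosed_iInter fun j =>
        isClosed_eq (by fun_prop) (by fun_prop)
    · simp only [Set.ofPred_forall]
      refine isClosed_iInter fun x => isClosed_le continuous_const ?_
      exact (quadForm_continuous n).comp (by fun_prop : Continuous fun P => (P, x))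
    · exact isClosed_le jsq_continuous continuous_const
  · refine (Metric.isBounded_iff_subset_closedBall 0).2 ⟨|C|, fun P hP => ?_⟩
    rw [mem_closedBall_zero_iff, pi_norm_le_iff_of_nonneg (abs_nonneg C)]
    intro i
    rw [pi_norm_le_iff_of_nonneg (abs_nonneg C)]
    intro j
    rw [Real.norm_eq_abs]
    refine sq_le_sq.1 (le_trans ?_ hP.2.2)
    calc P i j ^ 2 ≤ ∑ j, P i j ^ 2 :=
          Finset.single_le_sum (f := fun j => P i j ^ 2) (fun _ _ => sq_nonneg _) (Finset.mem_univ j)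
      _ ≤ jsq P := Finset.single_le_sum (f := fun i => ∑ j, P i j ^ 2)
          (fun _ _ => Finset.sum_nonneg fun _ _ => sq_nonneg _) (Finset.mem_univ i)

lemma quadForm_single {n : ℕ} (P : Matrix (Fin n) (Fin n) ℝ) (i : Fin n) :
    quadForm P (Pi.single i 1) = P i i := by
  rw [quadForm_eq]; simp

lemma JK_tr {n : ℕ} (hn : 1 ≤ n) {C : ℝ} {P : Fin n → Fin n → ℝ} (hP : P ∈ JK n C) :
    0 < ∑ i, P i i := by
  have : ∀ i, 1 ≤ P i i := by
    intro i
    refine le_trans ?_ ((hP.2.1 (Pi.single i 1)).trans_eq (quadForm_single P i))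
    simp [Pi.single_apply]
  have h0 : Nonempty (Fin n) := ⟨⟨0, hn⟩⟩
  exact Finset.sum_pos (fun i _ => by linarith [this i]) Finset.univ_nonempty

lemma quadForm_zero_imp {n : ℕ} {B : Matrix (Fin n) (Fin n) ℝ} (hB : ∀ i j, B i j = B j i)
    (h : ∀ x, quadForm B x = 0) : B = 0 := by
  ext i j
  have h1 := h (Pi.single i 1)
  have h2 := h (Pi.single j 1)
  have h3 := h (Pi.single i 1 + Pi.single j 1)
  rw [quadForm_single] at h1 h2
  rw [quadForm_eq] at h3
  simp [Matrix.mulVec_add] at h3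
  have := hB i j
  simp only [Matrix.zero_apply]
  linarith

lemma sample_norm {n m : ℕ} (δ : JsrSample n m) : ∑ i, samplePoint δ i ^ 2 = 1 := by
  have h : ‖(δ.2 : EuclideanSpace ℝ (Fin n))‖ = 1 := by simp
  have h2 := EuclideanSpace.norm_sq_eq (δ.2 : EuclideanSpace ℝ (Fin n))
  rw [h] at h2
  simp only [Real.norm_eq_abs, sq_abs] at h2
  simpa [samplePoint] using h2.symm

/-- A nonzero quadratic form vanishes only on a null set. -/
lemma quadForm_null {n : ℕ} (B : Matrix (Fin n) (Fin n) ℝ) (v : Fin n → ℝ)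
    (hv : quadForm B v ≠ 0) :
    (volume : Measure (EuclideanSpace ℝ (Fin n))) {x | quadForm B (fun i => x i) = 0} = 0 := by
  have hcont : Continuous fun x : EuclideanSpace ℝ (Fin n) => quadForm B (fun i => x i) := by
    unfold quadForm; fun_prop
  have hcl : IsClosed {x : EuclideanSpace ℝ (Fin n) | quadForm B (fun i => x i) = 0} :=
    isClosed_eq hcont continuous_const
  let L : ℝ →ₗ[ℝ] EuclideanSpace ℝ (Fin n) := LinearMap.toSpanSingleton ℝ _ (WithLp.toLp 2 v)
  have key := MeasureTheory.ae_mem_of_ae_add_linearMap_mem L (volume : Measure ℝ)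
    (volume : Measure (EuclideanSpace ℝ (Fin n)))
    (s := {x : EuclideanSpace ℝ (Fin n) | quadForm B (fun i => x i) = 0}ᶜ)
    hcl.measurableSet.compl ?_
  · rw [ae_iff] at key
    convert key using 2
    ext x
    simp
  · intro y
    rw [ae_iff]
    refine Set.Finite.measure_zero ?_ _
    let p : Polynomial ℝ := Polynomial.C (quadForm B v) * Polynomial.X ^ 2 +
      Polynomial.C ((fun i => y i) ⬝ᵥ B *ᵥ v + v ⬝ᵥ B *ᵥ (fun i => y i)) * Polynomial.X +
      Polynomial.C (quadForm B (fun i => y i))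
    have hp : p ≠ 0 := by
      intro h
      have := congrArg (fun q => Polynomial.coeff q 2) h
      simp [p] at this
      exact hv this
    refine (Polynomial.finite_setOfPred_isRoot hp).subset ?_
    intro t ht
    simp only [L, Set.mem_compl_iff, not_not, Set.mem_ofPred_eq] at ht
    simp only [Polynomial.IsRoot, Set.mem_ofPred_eq, p]
    simp only [Polynomial.eval_add, Polynomial.eval_mul, Polynomial.eval_C, Polynomial.eval_pow,
      Polynomial.eval_X]
    rw [← ht]
    have : (fun i => (y + (LinearMap.toSpanSingleton ℝ (EuclideanSpace ℝ (Fin n))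
        (WithLp.toLp 2 v)) t) i) = (fun i => y i) + t • v := by
      ext i; simp
    rw [this]
    simp only [quadForm_eq, Matrix.mulVec_add, Matrix.mulVec_smul, dotProduct_add, add_dotProduct,
      dotProduct_smul, smul_dotProduct, smul_eq_mul]
    ring

lemma quadForm_sphere_null {n : ℕ} (B : Matrix (Fin n) (Fin n) ℝ) (v : Fin n → ℝ)
    (hv : quadForm B v ≠ 0) :
    (volume : Measure (EuclideanSpace ℝ (Fin n))).toSphere
      {x | quadForm B (fun i => (x : EuclideanSpace ℝ (Fin n)) i) = 0} = 0 := by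
  have hcont : Continuous fun x : EuclideanSpace ℝ (Fin n) => quadForm B (fun i => x i) := by
    unfold quadForm; fun_prop
  have hcl : IsClosed {x : sphere (0 : EuclideanSpace ℝ (Fin n)) 1 |
      quadForm B (fun i => (x : EuclideanSpace ℝ (Fin n)) i) = 0} :=
    isClosed_eq (hcont.comp continuous_subtype_val) continuous_const
  rw [Measure.toSphere_apply' _ hcl.measurableSet]
  refine mul_eq_zero_of_right _ (measure_mono_null ?_ (quadForm_null B v hv))
  rintro _ ⟨t, ht, _, ⟨x, hx, rfl⟩, rfl⟩
  simp only [Set.mem_ofPred_eq] at hx ⊢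
  have : (fun i => (t • (x : EuclideanSpace ℝ (Fin n))) i) =
      t • fun i => (x : EuclideanSpace ℝ (Fin n)) i := by
    ext i; simp
  rw [quadForm_eq] at hx
  rw [this, quadForm_eq, Matrix.mulVec_smul, dotProduct_smul, smul_dotProduct, hx]
  simp

lemma jsrUniform_prob {n m : ℕ} (hn : 1 ≤ n) (hm : 1 ≤ m) :
    IsProbabilityMeasure (jsrUniform n m) := by
  have h0 : Nonempty (Fin n) := ⟨⟨0, hn⟩⟩
  have i1 : IsProbabilityMeasure ((m : ℝ≥0∞)⁻¹ • (Measure.count : Measure (Fin m))) := by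
    refine ⟨?_⟩
    simp only [Measure.smul_apply, smul_eq_mul, Measure.count_univ, ENat.card_eq_coe_fintype_card,
      Fintype.card_fin]
    have : ((m : ℕ∞) : ℝ≥0∞) = (m : ℝ≥0∞) := by simp
    rw [this]
    exact ENNReal.inv_mul_cancel (by simp; omega) (by simp)
  have i2 : IsProbabilityMeasure (((volume : Measure (EuclideanSpace ℝ (Fin n))).toSphere Set.univ)⁻¹ •
      (volume : Measure (EuclideanSpace ℝ (Fin n))).toSphere) := by
    refine ⟨?_⟩
    simp only [Measure.smul_apply, smul_eq_mul]
    refine ENNReal.inv_mul_cancel ?_ (measure_ne_top _ _)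
    rw [Measure.toSphere_apply_univ]
    refine mul_ne_zero ?_ ?_
    · simp; omega
    · exact (measure_ball_pos _ _ one_pos).ne'
  unfold jsrUniform
  infer_instance

lemma jsr_null {n m : ℕ}
    (B : Fin m → Matrix (Fin n) (Fin n) ℝ) (hB : ∀ k, ∃ v, quadForm (B k) v ≠ 0) :
    jsrUniform n m {δ | quadForm (B δ.1) (samplePoint δ) = 0} = 0 := by
  have hmeas : MeasurableSet {δ : JsrSample n m | quadForm (B δ.1) (samplePoint δ) = 0} := by
    have : IsClosed {δ : JsrSample n m | quadForm (B δ.1) (samplePoint δ) = 0} := by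
      refine isClosed_eq ?_ continuous_const
      unfold quadForm samplePoint
      have hBc : Continuous B := continuous_of_discreteTopology
      fun_prop
    exact this.measurableSet
  have : SFinite (((volume : Measure (EuclideanSpace ℝ (Fin n))).toSphere Set.univ)⁻¹ •
      (volume : Measure (EuclideanSpace ℝ (Fin n))).toSphere) := inferInstance
  unfold jsrUniform
  rw [Measure.measure_prod_null hmeas]
  refine Filter.Eventually.of_forall fun k => ?_
  obtain ⟨v, hv⟩ := hB k
  have := quadForm_sphere_null (B k) v hv
  simp only [Measure.smul_apply, smul_eq_mul, Pi.zero_apply]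
  exact mul_eq_zero_of_right _ this

lemma barabanov_form {n : ℕ} {A : Matrix (Fin n) (Fin n) ℝ} (hA : ¬ IsBarabanov A) {C : ℝ}
    {P : Matrix (Fin n) (Fin n) ℝ} (hP : P ∈ JK n C) {γ : ℝ} (hγ : 0 ≤ γ) :
    ∃ v, quadForm (Aᵀ * P * A - γ ^ 2 • P) v ≠ 0 := by
  by_contra hcon
  push Not at hcon
  have hsym : P.IsSymm := by ext i j; exact hP.1 j i
  have hB : (Aᵀ * P * A - γ ^ 2 • P).IsSymm := by
    rw [Matrix.IsSymm, Matrix.transpose_sub, Matrix.transpose_smul, hsym.eq, Matrix.transpose_mul,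
      Matrix.transpose_mul, hsym.eq, Matrix.transpose_transpose, Matrix.mul_assoc]
  have h0 := quadForm_zero_imp (fun i j => hB.apply j i) hcon
  refine hA ⟨P, hsym, ?_, γ, hγ, sub_eq_zero.1 h0⟩
  rw [Matrix.posDef_iff_dotProduct_mulVec]
  refine ⟨by rw [Matrix.IsHermitian, Matrix.conjTranspose_eq_transpose_of_trivial]; exact hsym,
    fun {x} hx => ?_⟩
  rw [star_trivial, ← quadForm_eq]
  refine lt_of_lt_of_le ?_ (hP.2.1 x)
  obtain ⟨i, hi⟩ := Function.ne_iff.1 hx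
  refine Finset.sum_pos' (fun _ _ => sq_nonneg _) ⟨i, Finset.mem_univ _, ?_⟩
  have : x i ≠ 0 := hi
  positivity

lemma quadForm_conj {n : ℕ} (A P : Matrix (Fin n) (Fin n) ℝ) (γ : ℝ) (x : Fin n → ℝ) :
    quadForm (Aᵀ * P * A - γ ^ 2 • P) x = quadForm P (A *ᵥ x) - γ ^ 2 * quadForm P x := by
  simp only [quadForm_eq, Matrix.sub_mulVec, dotProduct_sub, Matrix.smul_mulVec, dotProduct_smul,
    smul_eq_mul]
  congr 1
  rw [Matrix.mul_assoc, ← Matrix.mulVec_mulVec, ← Matrix.mulVec_mulVec, Matrix.dotProduct_mulVec,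
    Matrix.vecMul_transpose]

end ConcretePart

section FinalPart

/-- The linear forms on the left of the constraints. -/
def jg {n m : ℕ} (𝒜 : Fin m → Matrix (Fin n) (Fin n) ℝ) (δ : JsrSample n m) :
    (Fin n → Fin n → ℝ) →ₗ[ℝ] ℝ := qfLin ((𝒜 δ.1).mulVec (samplePoint δ))

/-- The linear forms on the right of the constraints. -/
def jh {n m : ℕ} (δ : JsrSample n m) : (Fin n → Fin n → ℝ) →ₗ[ℝ] ℝ := qfLin (samplePoint δ)

lemma jfeas_iff {n m : ℕ} (𝒜 : Fin m → Matrix (Fin n) (Fin n) ℝ) {C : ℝ} (hC : 0 ≤ C)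
    (S : Set (JsrSample n m)) (γ : ℝ) (P : Matrix (Fin n) (Fin n) ℝ) :
    JsrFeasible 𝒜 C S γ P ↔ JFeas (JK n C) (jg 𝒜) jh S γ P := by
  have h := JK_iff hC P
  have h' : (∀ δ ∈ S, quadForm P ((𝒜 δ.1).mulVec (samplePoint δ)) ≤
      γ ^ 2 * quadForm P (samplePoint δ)) ↔ ∀ δ ∈ S, jcon (jg 𝒜) jh γ P δ ≤ 0 := by
    refine forall_congr' fun δ => forall_congr' fun _ => ?_
    exact sub_nonpos.symm
  constructor
  · rintro ⟨a, b, c, e, f⟩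
    exact ⟨a, h.1 ⟨b, c, e⟩, h'.1 f⟩
  · rintro ⟨a, b, f⟩
    obtain ⟨b1, b2, b3⟩ := h.2 b
    exact ⟨a, b1, b2, b3, h'.2 f⟩

lemma jcon_cont {n m : ℕ} (𝒜 : Fin m → Matrix (Fin n) (Fin n) ℝ) :
    Continuous fun p : ℝ × (Fin n → Fin n → ℝ) × JsrSample n m =>
      jcon (jg 𝒜) jh p.1 p.2.1 p.2.2 := by
  have hs : Continuous (samplePoint : JsrSample n m → Fin n → ℝ) := by
    unfold samplePoint; fun_prop
  have hA : Continuous 𝒜 := continuous_of_discreteTopology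
  have h1 : Continuous fun p : ℝ × (Fin n → Fin n → ℝ) × JsrSample n m =>
      quadForm p.2.1 ((𝒜 p.2.2.1).mulVec (samplePoint p.2.2)) := by
    refine (quadForm_continuous n).comp (Continuous.prodMk (by fun_prop) ?_)
    exact Continuous.matrix_mulVec
      (A := fun p : ℝ × (Fin n → Fin n → ℝ) × JsrSample n m => 𝒜 p.2.2.1)
      (hA.comp (by fun_prop)) (hs.comp (by fun_prop))
  have h2 : Continuous fun p : ℝ × (Fin n → Fin n → ℝ) × JsrSample n m =>
      quadForm p.2.1 (samplePoint p.2.2) :=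
    (quadForm_continuous n).comp (Continuous.prodMk (by fun_prop) (by fun_prop))
  exact h1.sub ((continuous_fst.pow 2).mul h2)

lemma exists_setup {n m : ℕ} (hn : 1 ≤ n)
    (𝒜 : Fin m → Matrix (Fin n) (Fin n) ℝ)
    (C : ℝ) (hC : (n : ℝ) ≤ C)
    (Cost : Set (JsrSample n m) → ℝ ×ₗ ℝ)
    (hCost : ∀ S : Set (JsrSample n m), S.Finite →
      IsLeast (JsrValues 𝒜 C S) (Cost S)) :
    ∃ D : JSetup n (JsrSample n m), D.K = JK n C ∧ D.g = jg 𝒜 ∧ D.h = jh ∧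
      ∀ S : Set (JsrSample n m), S.Finite → Cost S = toLex ((D.θ S).1, jsq (D.θ S).2) := by
  have hC0 : 0 ≤ C := le_trans (Nat.cast_nonneg n) hC
  have hex : ∀ S : Set (JsrSample n m), ∃ p : ℝ × (Fin n → Fin n → ℝ), S.Finite →
      JFeas (JK n C) (jg 𝒜) jh S p.1 p.2 ∧ Cost S = toLex (p.1, jsq p.2) := by
    intro S
    by_cases hS : S.Finite
    · obtain ⟨γ, P, h1, h2⟩ := (hCost S hS).1
      refine ⟨(γ, P), fun _ => ⟨(jfeas_iff 𝒜 hC0 S γ P).1 h1, ?_⟩⟩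
      rw [h2, frobNorm_sq]
    · exact ⟨0, fun h => absurd h hS⟩
  choose θ hθ using hex
  refine ⟨{ K := JK n C, g := jg 𝒜, h := jh, conv := JK_convex n C, symm := fun P hP => hP.1,
            tr := fun P hP => JK_tr hn hP, gnn := ?_, hpos := ?_, θ := θ,
            feas := fun S hS => (hθ S hS).1, opt := ?_ }, rfl, rfl, rfl,
            fun S hS => (hθ S hS).2⟩
  · intro δ P hP
    exact le_trans (Finset.sum_nonneg fun _ _ => sq_nonneg _) (hP.2.1 _)
  · intro δ P hP
    have := hP.2.1 (samplePoint δ)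
    rw [sample_norm] at this
    exact lt_of_lt_of_le one_pos this
  · intro S hS γ P hF
    have h1 := (hCost S hS).2 ⟨γ, P, (jfeas_iff 𝒜 hC0 S γ P).2 hF, rfl⟩
    rw [(hθ S hS).2, Prod.Lex.toLex_le_toLex] at h1
    have h2 : frobNorm (P : Matrix (Fin n) (Fin n) ℝ) ^ 2 = jsq P := frobNorm_sq P
    rcases h1 with h1 | ⟨h1, h3⟩
    · exact Or.inl h1
    · exact Or.inr ⟨h1, h3.trans_eq h2⟩

end FinalPart

/-- Chance-constrained bound for the data-driven JSR problem: if no matrix of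
`𝒜` is Barabanov, then for `N ≥ d := n(n+1)/2` i.i.d. samples and `ε ∈ (0,1)`,
`ℙ^N({ω̄_N : V_jsr(ω̄_N) > ε}) ≤ Φ(ε, d-1, N) = ∑_{j=0}^{d-1} C(N,j) ε^j (1-ε)^{N-j}`. -/
theorem chance_constrained_jsr
    {n m : ℕ} (hn : 1 ≤ n) (hm : 1 ≤ m)
    (𝒜 : Fin m → Matrix (Fin n) (Fin n) ℝ)
    (hBar : ∀ k : Fin m, ¬ IsBarabanov (𝒜 k))
    (C : ℝ) (hC : (n : ℝ) ≤ C)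
    -- `Cost S` is the optimal value of the sampled problem `P_jsr(S)`
    (Cost : Set (JsrSample n m) → ℝ ×ₗ ℝ)
    (hCost : ∀ S : Set (JsrSample n m), S.Finite →
      IsLeast (JsrValues 𝒜 C S) (Cost S))
    (d : ℕ) (hd : d = n * (n + 1) / 2)
    (N : ℕ) (hN : d ≤ N) (ε : ℝ) (hε : ε ∈ Set.Ioo (0 : ℝ) 1) :
    (Measure.pi fun _ : Fin N => jsrUniform n m)
        {ωbar : Fin N → JsrSample n m |
          jsrUniform n m
              {δ : JsrSample n m |
                Cost (Set.range ωbar) < Cost (insert δ (Set.range ωbar))}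
            > ENNReal.ofReal ε}
      ≤ ENNReal.ofReal
          (∑ j ∈ Finset.range d, (N.choose j : ℝ) * ε ^ j * (1 - ε) ^ (N - j)) := by
  have hprob := jsrUniform_prob hn hm
  obtain ⟨D, hK, hg, hh, hcost⟩ := exists_setup hn 𝒜 C hC Cost hCost
  have hcont : Continuous fun p : ℝ × (Fin n → Fin n → ℝ) × JsrSample n m =>
      jcon D.g D.h p.1 p.2.1 p.2.2 := by
    rw [hg, hh]; exact jcon_cont 𝒜
  have hset : ∀ ω : Fin N → JsrSample n m,
      {δ : JsrSample n m | Cost (Set.range ω) < Cost (insert δ (Set.range ω))} =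
      {δ | 0 < jcon D.g D.h (D.θ (Set.range ω)).1 (D.θ (Set.range ω)).2 δ} := by
    intro ω
    have hS : (Set.range ω).Finite := Set.finite_range ω
    ext δ
    have hT : (insert δ (Set.range ω)).Finite := hS.insert δ
    have hsub : Set.range ω ⊆ insert δ (Set.range ω) := Set.subset_insert _ _
    have fS := D.feas _ hS
    have fT := D.feas _ hT
    simp only [Set.mem_ofPred_eq]
    rw [hcost _ hS, hcost _ hT]
    constructor
    · intro h
      by_contra hc
      push Not at hc
      have : D.θ (insert δ (Set.range ω)) = D.θ (Set.range ω) := by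
        refine D.loc _ _ hT hsub ?_
        rintro δ' (rfl | hδ')
        · exact hc
        · exact fS.2.2 _ hδ'
      rw [this] at h
      exact lt_irrefl _ h
    · intro h
      rw [Prod.Lex.toLex_lt_toLex]
      by_contra hc
      push Not at hc
      have hθ : D.θ (insert δ (Set.range ω)) = D.θ (Set.range ω) := by
        rcases D.opt _ hS _ _ (fT.mono hsub) with a | ⟨a, b⟩
        · exact absurd a (not_lt.2 hc.1)
        · exact D.uniq _ hS _ (fT.mono hsub) a.symm (hc.2 a)
      have := fT.2.2 δ (Set.mem_insert _ _)
      rw [hθ] at this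
      linarith
  simp only [hset]
  have hd1 : 1 ≤ d := by
    rw [hd, Nat.le_div_iff_mul_le (by norm_num)]
    nlinarith
  refine abstract_bound (jsrUniform n m) D.θ (fun p δ => jcon D.g D.h p.1 p.2 δ) ?_ ?_ ?_ ?_ ?_ ?_
    d hd1 ?_ N hN ε hε
  · have : Continuous fun p : (ℝ × (Fin n → Fin n → ℝ)) × JsrSample n m =>
        jcon D.g D.h p.1.1 p.1.2 p.2 :=
      hcont.comp (by fun_prop : Continuous fun p : (ℝ × (Fin n → Fin n → ℝ)) × JsrSample n m =>
        (p.1.1, p.1.2, p.2))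
    exact this.measurable
  · intro k
    refine D.meas_theta k (C ^ 2) ?_ ?_ hcont
    · rw [hK]; exact fun P hP => hP.2.2
    · rw [hK]; exact JK_compact n C
  · intro S hS
    have fS := D.feas S hS
    rw [hK] at fS
    let P : Matrix (Fin n) (Fin n) ℝ := (D.θ S).2
    have := jsr_null (fun k => (𝒜 k)ᵀ * P * (𝒜 k) - (D.θ S).1 ^ 2 • P)
      (fun k => barabanov_form (hBar k) fS.2.1 fS.1)
    convert this using 2
    ext δ
    simp only [Set.mem_ofPred_eq]
    rw [hg, hh]
    exact (Eq.congr_left (quadForm_conj (𝒜 δ.1) P (D.θ S).1 (samplePoint δ))).symm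
  · exact fun S hS => (D.feas S hS).2.2
  · exact fun S T hT hST h => D.loc S T hT hST h
  · exact fun S T hT hST h => D.act S T hT hST h
  · rw [hd]; exact D.helly hn
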